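/- arXiv:1605.08605 — 2 statements merged into one kernel-verified Lean document; each statement's English description precedes it below -/
import Mathlib

section
/- FKG inequality for positively correlated Gaussian vectors (Pitt): let φ = (φ₁,…,φ_k) be a centered Gaussian vector in ℝ^k whose covariance matrix has all entries nonnegative. Then for any two bounded, coordinatewise nondecreasing, measurable functions F, G : ℝ^k → ℝ, one has E[F(φ)G(φ)] ≥ E[F(φ)]·E[G(φ)]. In particular, for any two increasing events A and B (events whose indicator functions are nondecreasing), P[A ∩ B] ≥ P[A]·P[B]. -/
open MeasureTheory ProbabilityTheory

section
variable {ι : Type*}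

/-- The average of `F (x + s • y)` over `y` distributed according to `μ`. -/
noncomputable def scaledAverage (μ : Measure (ι → ℝ)) (s : ℝ) (F : (ι → ℝ) → ℝ) (x : ι → ℝ) : ℝ :=
  ∫ y, F (x + s • y) ∂μ

/-- `F` is bounded by `L` and has a first order expansion with gradient `a`, whose coordinates lie
in `[0, L]`, and with uniformly quadratic remainder. -/
structure IsSmoothIncreasing [Fintype ι] (L K : ℝ) (F : (ι → ℝ) → ℝ) (a : ι → (ι → ℝ) → ℝ) :
    Prop where
  measurable : Measurable F
  abs_le : ∀ x, |F x| ≤ L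
  measurable_grad : ∀ i, Measurable (a i)
  grad_nonneg : ∀ i x, 0 ≤ a i x
  grad_le : ∀ i x, a i x ≤ L
  taylor : ∀ x h, |F (x + h) - F x - ∑ i, a i x * h i| ≤ K * ‖h‖ ^ 2

lemma integrable_of_measurable_of_abs_le {α : Type*} [MeasurableSpace α] {μ : Measure α}
    [IsFiniteMeasure μ] {f : α → ℝ} (hf : Measurable f) {L : ℝ} (hL : ∀ x, |f x| ≤ L) :
    Integrable f μ :=
  .of_bound hf.aestronglyMeasurable L (.of_forall hL)

lemma integrable_sub_const_mul_sub_const {α : Type*} [MeasurableSpace α] {μ : Measure α}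
    [IsFiniteMeasure μ] {f g : α → ℝ} (hf : Integrable f μ) (hg : Integrable g μ)
    (hfg : Integrable (fun x => f x * g x) μ) (p q : ℝ) :
    Integrable (fun x => (f x - p) * (g x - q)) μ := by
  have := ((hfg.sub (hf.mul_const q)).sub (hg.const_mul p)).add (integrable_const (p * q))
  refine this.congr (.of_forall fun x => ?_)
  simp only [Pi.add_apply, Pi.sub_apply]
  ring

lemma integral_sub_const_mul_sub_const {α : Type*} [MeasurableSpace α] {μ : Measure α}
    [IsProbabilityMeasure μ] {f g : α → ℝ} (hf : Integrable f μ) (hg : Integrable g μ)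
    (hfg : Integrable (fun x => f x * g x) μ) (p q : ℝ) :
    ∫ x, (f x - p) * (g x - q) ∂μ - (∫ x, (f x - p) ∂μ) * ∫ x, (g x - q) ∂μ
      = ∫ x, f x * g x ∂μ - (∫ x, f x ∂μ) * ∫ x, g x ∂μ := by
  have h1 : Integrable (fun x => f x * g x - f x * q) μ := hfg.sub (hf.mul_const q)
  have h2 : Integrable (fun x => f x * g x - f x * q - p * g x) μ := h1.sub (hg.const_mul p)
  have e : ∀ x, (f x - p) * (g x - q) = f x * g x - f x * q - p * g x + p * q := fun x => by ring
  simp only [e]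
  rw [integral_add h2 (integrable_const _), integral_sub h1 (hg.const_mul p),
    integral_sub hfg (hf.mul_const q), integral_sub hf (integrable_const _),
    integral_sub hg (integrable_const _), integral_mul_const, integral_const_mul]
  simp only [integral_const, probReal_univ, one_smul]
  ring

variable {μ : Measure (ι → ℝ)} [IsProbabilityMeasure μ]

lemma integrable_comp_add_smul {F : (ι → ℝ) → ℝ} (hF : Measurable F) {L : ℝ}
    (hL : ∀ x, |F x| ≤ L) (s : ℝ) (x : ι → ℝ) : Integrable (fun y => F (x + s • y)) μ :=
  integrable_of_measurable_of_abs_le (by fun_prop) (fun _ => hL _)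

lemma measurable_scaledAverage {F : (ι → ℝ) → ℝ} (hF : Measurable F) (s : ℝ) :
    Measurable (scaledAverage μ s F) := by
  have : StronglyMeasurable (fun p : (ι → ℝ) × (ι → ℝ) => F (p.1 + s • p.2)) :=
    Measurable.stronglyMeasurable (by fun_prop)
  exact this.integral_prod_right.measurable

lemma scaledAverage_le {F : (ι → ℝ) → ℝ} (hF : Measurable F) {L : ℝ}
    (hL : ∀ x, |F x| ≤ L) (s : ℝ) {M : ℝ} (hM : ∀ x, F x ≤ M) (x : ι → ℝ) :
    scaledAverage μ s F x ≤ M := by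
  have := integral_mono (μ := μ) (integrable_comp_add_smul hF hL s x) (integrable_const M)
    (fun _ => hM _)
  simpa [scaledAverage] using this

lemma le_scaledAverage {F : (ι → ℝ) → ℝ} (hF : Measurable F) {L : ℝ}
    (hL : ∀ x, |F x| ≤ L) (s : ℝ) {M : ℝ} (hM : ∀ x, M ≤ F x) (x : ι → ℝ) :
    M ≤ scaledAverage μ s F x := by
  have := integral_mono (μ := μ) (integrable_const M) (integrable_comp_add_smul hF hL s x)
    (fun _ => hM _)
  simpa [scaledAverage] using this

lemma abs_scaledAverage_le {F : (ι → ℝ) → ℝ} (hF : Measurable F) {L : ℝ}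
    (hL : ∀ x, |F x| ≤ L) (s : ℝ) (x : ι → ℝ) : |scaledAverage μ s F x| ≤ L :=
  abs_le.2 ⟨le_scaledAverage hF hL s (fun x => (abs_le.1 (hL x)).1) x,
    scaledAverage_le hF hL s (fun x => (abs_le.1 (hL x)).2) x⟩

lemma abs_mul_le_mul_self {α : Type*} {F G : α → ℝ} {L : ℝ} (hF : ∀ x, |F x| ≤ L)
    (hG : ∀ x, |G x| ≤ L) (x : α) : |F x * G x| ≤ L * L := by
  rw [abs_mul]
  exact mul_le_mul (hF x) (hG x) (abs_nonneg _) ((abs_nonneg _).trans (hF x))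

/-- If `μ` is the law of `c • (Y + Y')` for independent `Y, Y'` with law `μ`, averaging at scale
`s` is averaging twice at scale `c * s`. -/
lemma scaledAverage_eq_scaledAverage_scaledAverage {c : ℝ}
    (hμ : (μ.prod μ).map (fun p => c • p.1 + c • p.2) = μ)
    {F : (ι → ℝ) → ℝ} (hF : Measurable F) {L : ℝ} (hL : ∀ x, |F x| ≤ L) (s : ℝ) (x : ι → ℝ) :
    scaledAverage μ s F x = scaledAverage μ (c * s) (scaledAverage μ (c * s) F) x := by
  conv_lhs => rw [scaledAverage, ← hμ]
  rw [integral_map (by fun_prop) (Measurable.aestronglyMeasurable (by fun_prop)), integral_prod]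
  · simp only [scaledAverage]
    congr! 5 with y z
    simp only [smul_add, smul_smul, mul_comm c s, add_assoc]
  · exact integrable_of_measurable_of_abs_le (by fun_prop) (fun _ => hL _)

variable [Fintype ι]

lemma IsSmoothIncreasing.average {L K : ℝ} {F : (ι → ℝ) → ℝ} {a : ι → (ι → ℝ) → ℝ}
    (h : IsSmoothIncreasing L K F a) (s : ℝ) :
    IsSmoothIncreasing L K (scaledAverage μ s F) (fun i => scaledAverage μ s (a i)) where
  measurable := measurable_scaledAverage h.measurable s
  abs_le := abs_scaledAverage_le h.measurable h.abs_le s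
  measurable_grad i := measurable_scaledAverage (h.measurable_grad i) s
  grad_nonneg i := le_scaledAverage (h.measurable_grad i)
    (fun x => (abs_of_nonneg (h.grad_nonneg i x)).trans_le (h.grad_le i x)) s (h.grad_nonneg i)
  grad_le i := scaledAverage_le (h.measurable_grad i)
    (fun x => (abs_of_nonneg (h.grad_nonneg i x)).trans_le (h.grad_le i x)) s (h.grad_le i)
  taylor x v := by
    have ha (i : ι) : Integrable (fun y => a i (x + s • y) * v i) μ :=
      (integrable_comp_add_smul (h.measurable_grad i)
        (fun x => (abs_of_nonneg (h.grad_nonneg i x)).trans_le (h.grad_le i x)) s x).mul_const _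
    have h1 := integrable_comp_add_smul (μ := μ) h.measurable h.abs_le s (x + v)
    have h2 := integrable_comp_add_smul (μ := μ) h.measurable h.abs_le s x
    have key : scaledAverage μ s F (x + v) - scaledAverage μ s F x
        - ∑ i, scaledAverage μ s (a i) x * v i
        = ∫ y, (F (x + s • y + v) - F (x + s • y) - ∑ i, a i (x + s • y) * v i) ∂μ := by
      have e : ∀ y, x + s • y + v = x + v + s • y := fun y => by abel
      simp only [e]
      have h12 : Integrable (fun y => F (x + v + s • y) - F (x + s • y)) μ := h1.sub h2
      rw [integral_sub h12 (integrable_finsetSum _ fun i _ => ha i),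
        integral_sub h1 h2, integral_finsetSum _ fun i _ => ha i]
      simp only [integral_mul_const, scaledAverage]
    rw [key, ← Real.norm_eq_abs]
    simpa using norm_integral_le_of_norm_le_const (μ := μ)
      (.of_forall fun y => (Real.norm_eq_abs _).trans_le (h.taylor (x + s • y) v))

/-- Covariance of `F` and `G` at small scale `s` is bounded below by `- C s ^ 3`. -/
lemma IsSmoothIncreasing.covariance_ge (h4 : Integrable (fun y => ‖y‖ ^ 4) μ)
    (hcent : ∀ i, ∫ y, y i ∂μ = 0) (hcov : ∀ i j, 0 ≤ ∫ y, y i * y j ∂μ)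
    {L K : ℝ} (hK : 0 ≤ K) :
    ∃ C, ∀ F G a b, IsSmoothIncreasing L K F a → IsSmoothIncreasing L K G b →
      ∀ s, 0 ≤ s → s ≤ 1 → ∀ x, - (C * s ^ 3) ≤
        scaledAverage μ s (fun z => F z * G z) x
          - scaledAverage μ s F x * scaledAverage μ s G x := by
  have hint {f : (ι → ℝ) → ℝ} (hf : Measurable f) (C : ℝ) (hb : ∀ y, |f y| ≤ C * (1 + ‖y‖ ^ 4)) :
      Integrable f μ := by
    refine Integrable.mono' (((integrable_const 1).add h4).const_mul C) hf.aestronglyMeasurable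
      (.of_forall hb)
  have hi (i : ι) (y : ι → ℝ) : |y i| ≤ ‖y‖ := norm_le_pi_norm y i
  have hint1 (i : ι) : Integrable (fun y : ι → ℝ => y i) μ := by
    refine hint (by fun_prop) 1 fun y => (hi i y).trans ?_
    nlinarith [sq_nonneg (‖y‖ ^ 2 - 1), sq_nonneg (‖y‖ - 1), norm_nonneg y]
  have hint2 (i j : ι) : Integrable (fun y : ι → ℝ => y i * y j) μ := by
    refine hint (by fun_prop) 1 fun y => ?_
    rw [abs_mul]
    nlinarith [mul_le_mul (hi i y) (hi j y) (abs_nonneg _) (norm_nonneg y),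
      sq_nonneg (‖y‖ ^ 2 - 1)]
  have hn2 : Integrable (fun y : ι → ℝ => ‖y‖ ^ 2) μ := by
    refine hint (by fun_prop) 1 fun y => ?_
    rw [abs_of_nonneg (by positivity)]
    nlinarith [sq_nonneg (‖y‖ ^ 2 - 1)]
  have hn3 : Integrable (fun y : ι → ℝ => ‖y‖ ^ 3) μ := by
    refine hint (by fun_prop) 1 fun y => ?_
    rw [abs_of_nonneg (by positivity)]
    nlinarith [sq_nonneg (‖y‖ ^ 2 - ‖y‖), sq_nonneg (‖y‖ ^ 2 - 1)]
  set N : ℝ := (Fintype.card ι : ℝ)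
  set m := ∫ y, ‖y‖ ^ 2 ∂μ
  have hm : 0 ≤ m := integral_nonneg fun _ => by positivity
  set R : (ι → ℝ) → ℝ := fun y => 2 * (N * L * K) * ‖y‖ ^ 3 + K ^ 2 * ‖y‖ ^ 4
  have hR : Integrable R μ := (hn3.const_mul _).add (h4.const_mul _)
  refine ⟨∫ y, R y ∂μ + (K * m) ^ 2, fun F G a b hF hG s hs hs1 x => ?_⟩
  have hL : 0 ≤ L := (abs_nonneg _).trans (hF.abs_le 0)
  have hs3 : s ^ 4 ≤ s ^ 3 := pow_le_pow_of_le_one hs hs1 (by norm_num)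
  -- the linear parts
  have lin_int (a : ι → (ι → ℝ) → ℝ) : Integrable (fun y => ∑ i, a i x * y i) μ :=
    integrable_finsetSum _ fun i _ => (hint1 i).const_mul _
  have lin_zero (a : ι → (ι → ℝ) → ℝ) : ∫ y, ∑ i, a i x * y i ∂μ = 0 := by
    rw [integral_finsetSum _ fun i _ => (hint1 i).const_mul _]
    simp [integral_const_mul, hcent]
  have lin_le {F a} (hF : IsSmoothIncreasing L K F a) (y : ι → ℝ) :
      |∑ i, a i x * y i| ≤ N * L * ‖y‖ := by
    calc |∑ i, a i x * y i| ≤ ∑ i, |a i x * y i| := Finset.abs_sum_le_sum_abs _ _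
      _ ≤ ∑ _i : ι, L * ‖y‖ := by
          refine Finset.sum_le_sum fun i _ => ?_
          rw [abs_mul, abs_of_nonneg (hF.grad_nonneg i x)]
          exact mul_le_mul (hF.grad_le i x) (hi i y) (abs_nonneg _) hL
      _ = N * L * ‖y‖ := by simp [N, mul_assoc]
  have rem_le {F a} (hF : IsSmoothIncreasing L K F a) (y : ι → ℝ) :
      |F (x + s • y) - F x - s * ∑ i, a i x * y i| ≤ K * s ^ 2 * ‖y‖ ^ 2 := by
    have := hF.taylor x (s • y)
    rw [norm_smul, mul_pow, Real.norm_eq_abs, sq_abs, ← mul_assoc] at this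
    convert this using 3
    simp only [Finset.mul_sum, Pi.smul_apply, smul_eq_mul]
    exact Finset.sum_congr rfl fun i _ => by ring
  have mean_le {F a} (hF : IsSmoothIncreasing L K F a) :
      |∫ y, (F (x + s • y) - F x) ∂μ| ≤ K * s ^ 2 * m := by
    have hFi : Integrable (fun y => F (x + s • y) - F x) μ :=
      (integrable_comp_add_smul hF.measurable hF.abs_le s x).sub (integrable_const (F x))
    have : ∫ y, (F (x + s • y) - F x) ∂μ
        = ∫ y, (F (x + s • y) - F x - s * ∑ i, a i x * y i) ∂μ := by
      rw [integral_sub hFi ((lin_int a).const_mul s), integral_const_mul, lin_zero a]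
      simp
    rw [this, ← Real.norm_eq_abs, ← integral_const_mul]
    exact norm_integral_le_of_norm_le (hn2.const_mul _) (.of_forall fun y => rem_le hF y)
  have prod_nonneg : 0 ≤ ∫ y, (∑ i, a i x * y i) * (∑ j, b j x * y j) ∂μ := by
    have e : ∀ y : ι → ℝ, (∑ i, a i x * y i) * (∑ j, b j x * y j)
        = ∑ i, ∑ j, (a i x * b j x) * (y i * y j) := fun y => by
      rw [Finset.sum_mul_sum]
      exact Finset.sum_congr rfl fun i _ => Finset.sum_congr rfl fun j _ => by ring
    simp only [e]
    rw [integral_finsetSum _ fun i _ => integrable_finsetSum _ fun j _ => (hint2 i j).const_mul _]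
    refine Finset.sum_nonneg fun i _ => ?_
    rw [integral_finsetSum _ fun j _ => (hint2 i j).const_mul _]
    refine Finset.sum_nonneg fun j _ => ?_
    rw [integral_const_mul]
    exact mul_nonneg (mul_nonneg (hF.grad_nonneg i x) (hG.grad_nonneg j x)) (hcov i j)
  have prod_int : Integrable (fun y => (∑ i, a i x * y i) * (∑ j, b j x * y j)) μ := by
    refine hint (by fun_prop) ((N * L) ^ 2) fun y => ?_
    rw [abs_mul]
    calc _ ≤ (N * L * ‖y‖) * (N * L * ‖y‖) :=
          mul_le_mul (lin_le hF y) (lin_le hG y) (abs_nonneg _) (by positivity)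
      _ = (N * L) ^ 2 * ‖y‖ ^ 2 := by ring
      _ ≤ _ := by gcongr; nlinarith [sq_nonneg (‖y‖ ^ 2 - 1)]
  have hFi := integrable_comp_add_smul (μ := μ) hF.measurable hF.abs_le s x
  have hGi := integrable_comp_add_smul (μ := μ) hG.measurable hG.abs_le s x
  have hFGi := integrable_comp_add_smul (μ := μ) (hF.measurable.mul hG.measurable)
    (abs_mul_le_mul_self hF.abs_le hG.abs_le) s x
  have hUV : Integrable (fun y => (F (x + s • y) - F x) * (G (x + s • y) - G x)) μ :=
    integrable_sub_const_mul_sub_const hFi hGi hFGi (F x) (G x)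
  have cov_eq : scaledAverage μ s (fun z => F z * G z) x
        - scaledAverage μ s F x * scaledAverage μ s G x
      = ∫ y, (F (x + s • y) - F x) * (G (x + s • y) - G x) ∂μ
        - (∫ y, (F (x + s • y) - F x) ∂μ) * ∫ y, (G (x + s • y) - G x) ∂μ :=
    (integral_sub_const_mul_sub_const hFi hGi hFGi (F x) (G x)).symm
  have main : ∫ y, (s ^ 2 * ((∑ i, a i x * y i) * (∑ j, b j x * y j)) - s ^ 3 * R y) ∂μ
      ≤ ∫ y, (F (x + s • y) - F x) * (G (x + s • y) - G x) ∂μ := by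
    refine integral_mono ((prod_int.const_mul _).sub (hR.const_mul _)) hUV fun y => ?_
    have r1 := rem_le hF y
    have r2 := rem_le hG y
    have l1 := lin_le hF y
    have l2 := lin_le hG y
    simp only
    set A := ∑ i, a i x * y i
    set B := ∑ i, b i x * y i
    set P := F (x + s • y) - F x - s * A with hP
    set Q := G (x + s • y) - G x - s * B with hQ
    have hA : F (x + s • y) - F x = s * A + P := by rw [hP]; ring
    have hB : G (x + s • y) - G x = s * B + Q := by rw [hQ]; ring
    rw [hA, hB]
    have n0 := norm_nonneg y
    have t1 : |A * Q| ≤ (N * L * ‖y‖) * (K * s ^ 2 * ‖y‖ ^ 2) := by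
      rw [abs_mul]; exact mul_le_mul l1 r2 (abs_nonneg _) (by positivity)
    have t2 : |B * P| ≤ (N * L * ‖y‖) * (K * s ^ 2 * ‖y‖ ^ 2) := by
      rw [abs_mul]; exact mul_le_mul l2 r1 (abs_nonneg _) (by positivity)
    have t3 : |P * Q| ≤ (K * s ^ 2 * ‖y‖ ^ 2) * (K * s ^ 2 * ‖y‖ ^ 2) := by
      rw [abs_mul]; exact mul_le_mul r1 r2 (abs_nonneg _) (by positivity)
    have u1 := mul_le_mul_of_nonneg_left (neg_le_of_abs_le t1) hs
    have u2 := mul_le_mul_of_nonneg_left (neg_le_of_abs_le t2) hs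
    have u3 := neg_le_of_abs_le t3
    have u4 : s ^ 4 * (K ^ 2 * ‖y‖ ^ 4) ≤ s ^ 3 * (K ^ 2 * ‖y‖ ^ 4) := by gcongr
    simp only [R]
    nlinarith [u1, u2, u3, u4]
  rw [integral_sub (prod_int.const_mul _) (hR.const_mul _), integral_const_mul,
    integral_const_mul] at main
  have hmean : (∫ y, (F (x + s • y) - F x) ∂μ) * ∫ y, (G (x + s • y) - G x) ∂μ
      ≤ s ^ 3 * (K * m) ^ 2 := by
    calc _ ≤ |(∫ y, (F (x + s • y) - F x) ∂μ) * ∫ y, (G (x + s • y) - G x) ∂μ| := le_abs_self _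
      _ ≤ (K * s ^ 2 * m) * (K * s ^ 2 * m) := by
          rw [abs_mul]; exact mul_le_mul (mean_le hF) (mean_le hG) (abs_nonneg _) (by positivity)
      _ = s ^ 4 * (K * m) ^ 2 := by ring
      _ ≤ _ := by gcongr
  rw [cov_eq]
  nlinarith [mul_nonneg (sq_nonneg s) prod_nonneg]

/-- A lower bound on all covariances at scale `c * s` gives twice that bound at scale `s`. -/
lemma covariance_ge_two_mul {c : ℝ} (hμ : (μ.prod μ).map (fun p => c • p.1 + c • p.2) = μ)
    {L K s δ : ℝ}
    (h : ∀ F G a b, IsSmoothIncreasing L K F a → IsSmoothIncreasing L K G b → ∀ x, - δ ≤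
        scaledAverage μ (c * s) (fun z => F z * G z) x
          - scaledAverage μ (c * s) F x * scaledAverage μ (c * s) G x)
    {F G : (ι → ℝ) → ℝ} {a b : ι → (ι → ℝ) → ℝ} (hF : IsSmoothIncreasing L K F a)
    (hG : IsSmoothIncreasing L K G b) (x : ι → ℝ) :
    - (2 * δ) ≤ scaledAverage μ s (fun z => F z * G z) x
          - scaledAverage μ s F x * scaledAverage μ s G x := by
  have hF' := hF.average (μ := μ) (c * s)
  have hG' := hG.average (μ := μ) (c * s)
  have hFG : Measurable fun z => F z * G z := hF.measurable.mul hG.measurable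
  have hFGb := abs_mul_le_mul_self hF.abs_le hG.abs_le
  rw [scaledAverage_eq_scaledAverage_scaledAverage hμ hF.measurable hF.abs_le,
    scaledAverage_eq_scaledAverage_scaledAverage hμ hG.measurable hG.abs_le,
    scaledAverage_eq_scaledAverage_scaledAverage hμ hFG hFGb]
  have h1 := h _ _ _ _ hF' hG' x
  have h2 : scaledAverage μ (c * s)
        (fun z => scaledAverage μ (c * s) F z * scaledAverage μ (c * s) G z) x - δ
      ≤ scaledAverage μ (c * s) (scaledAverage μ (c * s) (fun z => F z * G z)) x := by
    have i1 := integrable_comp_add_smul (μ := μ) (hF'.measurable.mul hG'.measurable)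
      (abs_mul_le_mul_self hF'.abs_le hG'.abs_le) (c * s) x
    have i2 := integrable_comp_add_smul (μ := μ) (measurable_scaledAverage (μ := μ) hFG (c * s))
      (abs_scaledAverage_le hFG hFGb (c * s)) (c * s) x
    have := integral_mono (i1.sub (integrable_const δ)) i2 fun y => by
      have := h _ _ _ _ hF hG (x + (c * s) • y)
      simp only [Pi.sub_apply, Pi.mul_apply]
      linarith
    simp only [Pi.sub_apply] at this
    rw [integral_sub i1 (integrable_const δ)] at this
    simpa [scaledAverage] using this
  linarith

lemma IsSmoothIncreasing.integral_mul_integral_le {c : ℝ} (hc0 : 0 ≤ c) (hc : 2 * c ^ 2 = 1)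
    (hμ : (μ.prod μ).map (fun p => c • p.1 + c • p.2) = μ)
    (h4 : Integrable (fun y => ‖y‖ ^ 4) μ)
    (hcent : ∀ i, ∫ y, y i ∂μ = 0) (hcov : ∀ i j, 0 ≤ ∫ y, y i * y j ∂μ)
    {L K : ℝ} (hK : 0 ≤ K) {F G : (ι → ℝ) → ℝ} {a b : ι → (ι → ℝ) → ℝ}
    (hF : IsSmoothIncreasing L K F a) (hG : IsSmoothIncreasing L K G b) :
    (∫ y, F y ∂μ) * (∫ y, G y ∂μ) ≤ ∫ y, F y * G y ∂μ := by
  obtain ⟨C, hC⟩ := IsSmoothIncreasing.covariance_ge h4 hcent hcov hK (L := L)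
  have hc1 : c < 1 := by nlinarith
  have step (n m : ℕ) : ∀ F G a b, IsSmoothIncreasing L K F a → IsSmoothIncreasing L K G b → ∀ x,
      - (2 ^ n * (C * (c ^ (n + m)) ^ 3)) ≤ scaledAverage μ (c ^ m) (fun z => F z * G z) x
          - scaledAverage μ (c ^ m) F x * scaledAverage μ (c ^ m) G x := by
    induction n generalizing m with
    | zero =>
      intro F G a b hF hG x
      simpa using hC F G a b hF hG (c ^ m) (by positivity) (pow_le_one₀ hc0 hc1.le) x
    | succ n ih =>
      intro F G a b hF hG x
      have := covariance_ge_two_mul hμ (s := c ^ m) (fun F G a b hF hG x => by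
        rw [← pow_succ']; exact ih (m + 1) F G a b hF hG x) hF hG x
      convert this using 2
      ring
  have hlim : Filter.Tendsto (fun n : ℕ => - (C * c ^ n)) Filter.atTop (nhds 0) := by
    simpa using ((tendsto_pow_atTop_nhds_zero_of_lt_one hc0 hc1).const_mul C).neg
  refine sub_nonneg.1 (le_of_tendsto' hlim fun n => ?_)
  have e : 2 ^ n * (C * (c ^ (n + 0)) ^ 3) = C * c ^ n := by
    calc 2 ^ n * (C * (c ^ (n + 0)) ^ 3) = C * c ^ n * (2 * c ^ 2) ^ n := by
          rw [add_zero, mul_pow]; ring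
      _ = C * c ^ n := by rw [hc]; simp
  have := step n 0 F G a b hF hG 0
  rw [e] at this
  simpa [scaledAverage] using this

lemma IsSmoothIncreasing.mono {L L' K K' : ℝ} {F : (ι → ℝ) → ℝ} {a : ι → (ι → ℝ) → ℝ}
    (h : IsSmoothIncreasing L K F a) (hL : L ≤ L') (hK : K ≤ K') :
    IsSmoothIncreasing L' K' F a where
  measurable := h.measurable
  abs_le x := (h.abs_le x).trans hL
  measurable_grad := h.measurable_grad
  grad_nonneg := h.grad_nonneg
  grad_le i x := (h.grad_le i x).trans hL
  taylor x v := (h.taylor x v).trans (by gcongr)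

open scoped Convolution in
lemma exists_isSmoothIncreasing_convolution {F : (ι → ℝ) → ℝ} {C : NNReal}
    (hF : LipschitzWith C F) (hmono : Monotone F) {M : ℝ} (hM : ∀ x, |F x| ≤ M)
    (φ : ContDiffBump (0 : ι → ℝ)) :
    ∃ L K a, 0 ≤ K ∧
      IsSmoothIncreasing L K (φ.normed volume ⋆[ContinuousLinearMap.lsmul ℝ ℝ, volume] F) a := by
  classical
  set η : (ι → ℝ) → ℝ := φ.normed volume with hη
  set H := η ⋆[ContinuousLinearMap.lsmul ℝ ℝ, volume] F with hH
  have hηc : HasCompactSupport η := φ.hasCompactSupport_normed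
  have hηd : ContDiff ℝ 1 η := φ.contDiff_normed
  have hex (x : ι → ℝ) : Integrable (fun u => η u * F (x - u)) :=
    hηc.convolutionExists_left (ContinuousLinearMap.lsmul ℝ ℝ) hηd.continuous
      hF.continuous.locallyIntegrable x
  have hHx (x : ι → ℝ) : H x = ∫ u, η u * F (x - u) := rfl
  have hHmono : Monotone H := fun x y hxy => by
    rw [hHx, hHx]
    exact integral_mono (hex x) (hex y) fun u =>
      mul_le_mul_of_nonneg_left (hmono (sub_le_sub_right hxy u)) (φ.nonneg_normed u)
  have hHM (x : ι → ℝ) : |H x| ≤ M := by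
    rw [hHx, ← Real.norm_eq_abs]
    calc _ ≤ ∫ u, η u * M := by
          refine norm_integral_le_of_norm_le (φ.integrable_normed.mul_const M)
            (.of_forall fun u => ?_)
          rw [norm_mul, Real.norm_of_nonneg (φ.nonneg_normed u)]
          exact mul_le_mul_of_nonneg_left (hM _) (φ.nonneg_normed u)
      _ = M := by rw [integral_mul_const, φ.integral_normed, one_mul]
  have hderiv (x : ι → ℝ) : HasFDerivAt H
      ((fderiv ℝ η ⋆[(ContinuousLinearMap.lsmul ℝ ℝ).precompL (ι → ℝ), volume] F) x) x :=
    hηc.hasFDerivAt_convolution_left _ hηd hF.continuous.locallyIntegrable x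
  set D := fderiv ℝ η ⋆[(ContinuousLinearMap.lsmul ℝ ℝ).precompL (ι → ℝ), volume] F with hD
  have hηf : Continuous (fderiv ℝ η) := hηd.continuous_fderiv one_ne_zero
  have hηfc : HasCompactSupport (fderiv ℝ η) := hηc.fderiv ℝ
  have hηi : Integrable (fun u => ‖fderiv ℝ η u‖) :=
    (hηf.integrable_of_hasCompactSupport hηfc).norm
  have hsmul (f : (ι → ℝ) →L[ℝ] ℝ) (r : ℝ) :
      (ContinuousLinearMap.lsmul ℝ ℝ : ℝ →L[ℝ] ℝ →L[ℝ] ℝ).precompL (ι → ℝ) f r = r • f := by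
    ext; simp [ContinuousLinearMap.precompL_apply, mul_comm]
  set K := C * ∫ u, ‖fderiv ℝ η u‖ with hK
  have hK0 : 0 ≤ K := by
    have : 0 ≤ ∫ u, ‖fderiv ℝ η u‖ := integral_nonneg fun _ => norm_nonneg _
    positivity
  have hDlip (x y : ι → ℝ) : ‖D x - D y‖ ≤ K * ‖x - y‖ := by
    have e1 := hηfc.convolutionExists_left
      ((ContinuousLinearMap.lsmul ℝ ℝ : ℝ →L[ℝ] ℝ →L[ℝ] ℝ).precompL (ι → ℝ)) hηf
      (hF.continuous.locallyIntegrable (μ := volume))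
    rw [hD, convolution_def, convolution_def, ← integral_sub (e1 x) (e1 y)]
    calc _ ≤ ∫ u, ‖fderiv ℝ η u‖ * (C * ‖x - y‖) := by
          refine norm_integral_le_of_norm_le (hηi.mul_const _) (.of_forall fun u => ?_)
          rw [hsmul, hsmul, ← sub_smul, norm_smul, mul_comm]
          have := hF.norm_sub_le (x - u) (y - u)
          rw [sub_sub_sub_cancel_right] at this
          gcongr
      _ = K * ‖x - y‖ := by rw [integral_mul_const, hK]; ring
  have htaylor (x h : ι → ℝ) : |H (x + h) - H x - D x h| ≤ K * ‖h‖ ^ 2 := by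
    have := (convex_closedBall x ‖h‖).norm_image_sub_le_of_norm_hasFDerivWithin_le'
      (f := H) (f' := D) (φ := D x) (C := K * ‖h‖) (x := x) (y := x + h)
      (fun z _ => (hderiv z).hasFDerivWithinAt)
      (fun z hz => (hDlip z x).trans (by
        rw [Metric.mem_closedBall, dist_eq_norm] at hz; gcongr))
      (by simp) (by simp)
    rw [add_sub_cancel_left, Real.norm_eq_abs] at this
    linarith [this, show K * ‖h‖ * ‖h‖ = K * ‖h‖ ^ 2 by ring]
  have hDc : Continuous D := by
    refine (LipschitzWith.of_dist_le_mul (K := ⟨K, hK0⟩) fun x y => ?_).continuous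
    rw [dist_eq_norm, dist_eq_norm]
    exact hDlip x y
  have hbasis (x : ι → ℝ) (i : ι) (t : ℝ) :
      |H (x + t • Pi.single i 1) - H x - t * D x (Pi.single i 1)| ≤ K * t ^ 2 := by
    have := htaylor x (t • Pi.single i 1)
    rwa [map_smul, norm_smul, Pi.norm_single, norm_one, mul_one, Real.norm_eq_abs, sq_abs] at this
  have hle (x : ι → ℝ) (i : ι) {t : ℝ} (ht : 0 ≤ t) : H x ≤ H (x + t • Pi.single i 1) := by
    apply hHmono
    have : (0 : ι → ℝ) ≤ t • Pi.single i 1 := smul_nonneg ht (by simp)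
    simpa using this
  refine ⟨M + M + K, K, fun i x => D x (Pi.single i 1), hK0, ?_⟩
  refine ⟨?_, fun x => ?_, fun i => ?_, fun i x => ?_, fun i x => ?_, fun x h => ?_⟩
  · exact (continuous_iff_continuousAt.2 fun x => (hderiv x).continuousAt).measurable
  · have := (abs_nonneg _).trans (hM 0)
    linarith [hHM x]
  · exact (hDc.clm_apply continuous_const).measurable
  · refine le_of_forall_pos_le_add fun ε hε => ?_
    set t := ε / (K + 1)
    have ht : 0 < t := by positivity
    have htK : K * t ≤ ε := by
      have : t * (K + 1) = ε := div_mul_cancel₀ _ (by positivity)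
      nlinarith
    have h1 := neg_le_of_abs_le (hbasis x i t)
    have h2 := le_of_abs_le (hbasis x i t)
    have h3 := hle x i ht.le
    have h4 : 0 ≤ t * (D x (Pi.single i 1) + K * t) := by nlinarith
    have := nonneg_of_mul_nonneg_right h4 ht
    linarith
  · have h1 := neg_le_of_abs_le (hbasis x i 1)
    have h2 := (abs_le.1 (hHM x)).1
    have h3 := (abs_le.1 (hHM (x + (1 : ℝ) • Pi.single i 1))).2
    linarith
  · convert htaylor x h using 3
    conv_rhs => rw [pi_eq_sum_univ' h, map_sum]
    refine Finset.sum_congr rfl fun i _ => ?_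
    rw [map_smul, smul_eq_mul, mul_comm]

lemma integral_mul_integral_le_of_tendsto {α : Type*} [MeasurableSpace α] {ν : Measure α}
    [IsFiniteMeasure ν] {Fn Gn : ℕ → α → ℝ} {F G : α → ℝ} {M : ℝ}
    (hFm : ∀ n, AEStronglyMeasurable (Fn n) ν) (hGm : ∀ n, AEStronglyMeasurable (Gn n) ν)
    (hFM : ∀ n x, |Fn n x| ≤ M) (hGM : ∀ n x, |Gn n x| ≤ M)
    (hF : ∀ x, Filter.Tendsto (fun n => Fn n x) Filter.atTop (nhds (F x)))
    (hG : ∀ x, Filter.Tendsto (fun n => Gn n x) Filter.atTop (nhds (G x)))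
    (h : ∀ n, (∫ x, Fn n x ∂ν) * (∫ x, Gn n x ∂ν) ≤ ∫ x, Fn n x * Gn n x ∂ν) :
    (∫ x, F x ∂ν) * (∫ x, G x ∂ν) ≤ ∫ x, F x * G x ∂ν := by
  have tF := tendsto_integral_of_dominated_convergence (fun _ => M) hFm (integrable_const M)
    (fun n => .of_forall (hFM n)) (.of_forall hF)
  have tG := tendsto_integral_of_dominated_convergence (fun _ => M) hGm (integrable_const M)
    (fun n => .of_forall (hGM n)) (.of_forall hG)
  have tFG := tendsto_integral_of_dominated_convergence (fun _ => M * M)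
    (fun n => (hFm n).mul (hGm n)) (integrable_const (M * M))
    (fun n => .of_forall (abs_mul_le_mul_self (hFM n) (hGM n)))
    (.of_forall fun x => (hF x).mul (hG x))
  exact le_of_tendsto_of_tendsto' (tF.mul tG) tFG h

open scoped Convolution in
lemma integral_mul_integral_le_of_lipschitzWith
    (h : ∀ {L K : ℝ}, 0 ≤ K → ∀ {F G : (ι → ℝ) → ℝ} {a b : ι → (ι → ℝ) → ℝ},
      IsSmoothIncreasing L K F a → IsSmoothIncreasing L K G b →
      (∫ y, F y ∂μ) * (∫ y, G y ∂μ) ≤ ∫ y, F y * G y ∂μ)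
    {F G : (ι → ℝ) → ℝ} {C C' : NNReal} (hF : LipschitzWith C F) (hG : LipschitzWith C' G)
    (hFmono : Monotone F) (hGmono : Monotone G) {M : ℝ} (hFM : ∀ x, |F x| ≤ M)
    (hGM : ∀ x, |G x| ≤ M) :
    (∫ y, F y ∂μ) * (∫ y, G y ∂μ) ≤ ∫ y, F y * G y ∂μ := by
  let φ (n : ℕ) : ContDiffBump (0 : ι → ℝ) :=
    ⟨1 / ((n : ℝ) + 1) / 2, 1 / ((n : ℝ) + 1), by positivity, half_lt_self (by positivity)⟩
  have hφ : Filter.Tendsto (fun n => (φ n).rOut) Filter.atTop (nhds 0) :=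
    tendsto_one_div_add_atTop_nhds_zero_nat
  let S (F : (ι → ℝ) → ℝ) (n : ℕ) : (ι → ℝ) → ℝ :=
    (φ n).normed volume ⋆[ContinuousLinearMap.lsmul ℝ ℝ, volume] F
  have hS {F : (ι → ℝ) → ℝ} {C : NNReal} (hF : LipschitzWith C F) (x : ι → ℝ) :
      Filter.Tendsto (fun n => S F n x) Filter.atTop (nhds (F x)) :=
    ContDiffBump.convolution_tendsto_right_of_continuous hφ hF.continuous x
  have hSM {F : (ι → ℝ) → ℝ} {C : NNReal} (hF : LipschitzWith C F) (hM : ∀ x, |F x| ≤ M)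
      (n : ℕ) (x : ι → ℝ) : |S F n x| ≤ M + (M + M) := by
    have hM0 : 0 ≤ M := (abs_nonneg _).trans (hM x)
    have h1 : dist (S F n x) (F x) ≤ M + M :=
      ContDiffBump.dist_normed_convolution_le hF.continuous.aestronglyMeasurable fun y _ => by
        rw [Real.dist_eq]
        exact (abs_sub _ _).trans (add_le_add (hM y) (hM x))
    rw [Real.dist_eq] at h1
    have := abs_add_le (F x) (S F n x - F x)
    rw [add_sub_cancel] at this
    linarith [hM x]
  refine integral_mul_integral_le_of_tendsto (Fn := S F) (Gn := S G) (fun n => ?_) (fun n => ?_)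
    (hSM hF hFM) (hSM hG hGM) (hS hF) (hS hG) fun n => ?_
  · obtain ⟨L, K, a, -, ha⟩ := exists_isSmoothIncreasing_convolution hF hFmono hFM (φ n)
    exact ha.measurable.aestronglyMeasurable
  · obtain ⟨L, K, a, -, ha⟩ := exists_isSmoothIncreasing_convolution hG hGmono hGM (φ n)
    exact ha.measurable.aestronglyMeasurable
  · obtain ⟨L, K, a, hK, ha⟩ := exists_isSmoothIncreasing_convolution hF hFmono hFM (φ n)
    obtain ⟨L', K', b, hK', hb⟩ := exists_isSmoothIncreasing_convolution hG hGmono hGM (φ n)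
    exact h (hK.trans (le_max_left K K')) (ha.mono (le_max_left L L') (le_max_left K K'))
      (hb.mono (le_max_right L L') (le_max_right K K'))

/-- If bounded Lipschitz nondecreasing functions are nonnegatively correlated, so are closed
upper sets. -/
lemma measure_mul_measure_le_of_isClosed
    (h : ∀ {F G : (ι → ℝ) → ℝ} {C C' : NNReal}, LipschitzWith C F → LipschitzWith C' G →
      Monotone F → Monotone G → ∀ {M : ℝ}, (∀ x, |F x| ≤ M) → (∀ x, |G x| ≤ M) →
      (∫ y, F y ∂μ) * (∫ y, G y ∂μ) ≤ ∫ y, F y * G y ∂μ)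
    {U V : Set (ι → ℝ)} (hU : IsClosed U) (hV : IsClosed V) (hU' : IsUpperSet U)
    (hV' : IsUpperSet V) : μ U * μ V ≤ μ (U ∩ V) := by
  let δ (n : ℕ) : ℝ := 1 / ((n : ℝ) + 1)
  have hδ (n : ℕ) : 0 < δ n := by positivity
  have hδ0 : Filter.Tendsto δ Filter.atTop (nhds 0) := tendsto_one_div_add_atTop_nhds_zero_nat
  let f (U : Set (ι → ℝ)) (n : ℕ) (x : ι → ℝ) : ℝ := (thickenedIndicator (hδ n) U x : NNReal)
  have hlip (U : Set (ι → ℝ)) (n : ℕ) : LipschitzWith (δ n).toNNReal⁻¹ (f U n) :=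
    lipschitzWith_thickenedIndicator (hδ n) U
  have hle (U : Set (ι → ℝ)) (n : ℕ) (x : ι → ℝ) : |f U n x| ≤ 1 := by
    rw [abs_of_nonneg (NNReal.coe_nonneg _)]
    exact_mod_cast thickenedIndicator_le_one (hδ n) U x
  have hmono {U : Set (ι → ℝ)} (hU : IsUpperSet U) (n : ℕ) : Monotone (f U n) := fun x y hxy => by
    refine NNReal.coe_le_coe.2 (thickenedIndicator_mono_infEDist (hδ n) ?_)
    refine Metric.le_infEDist.2 fun u hu => ?_
    have : u + (y - x) ∈ U := hU (by simpa using hxy) hu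
    refine (Metric.infEDist_le_edist_of_mem this).trans_eq ?_
    rw [edist_eq_enorm_sub, edist_eq_enorm_sub]
    congr 1
    abel
  have hlim {U : Set (ι → ℝ)} (hU : IsClosed U) (x : ι → ℝ) :
      Filter.Tendsto (fun n => f U n x) Filter.atTop (nhds (U.indicator 1 x)) := by
    have := tendsto_pi_nhds.1 (thickenedIndicator_tendsto_indicator_closure hδ hδ0 U) x
    rw [hU.closure_eq] at this
    convert NNReal.tendsto_coe.2 this
    by_cases hx : x ∈ U <;> simp [hx]
  have key := integral_mul_integral_le_of_tendsto (ν := μ)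
    (fun n => (hlip U n).continuous.aestronglyMeasurable)
    (fun n => (hlip V n).continuous.aestronglyMeasurable) (hle U) (hle V) (hlim hU) (hlim hV)
    fun n => h (hlip U n) (hlip V n) (hmono hU' n) (hmono hV' n) (hle U n) (hle V n)
  have e : (fun x => U.indicator (1 : (ι → ℝ) → ℝ) x * V.indicator (1 : (ι → ℝ) → ℝ) x)
      = (U ∩ V).indicator 1 := by
    ext x
    rw [Set.inter_indicator_one, Pi.mul_apply]
  rw [e, integral_indicator_one hU.measurableSet, integral_indicator_one hV.measurableSet,
    integral_indicator_one (hU.inter hV).measurableSet] at key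
  rw [← ENNReal.toReal_le_toReal (by finiteness) (by finiteness), ENNReal.toReal_mul]
  exact key

lemma exists_isClosed_isUpperSet_lt {A : Set (ι → ℝ)} (hA : MeasurableSet A) (hA' : IsUpperSet A)
    {r : ENNReal} (hr : r < μ A) : ∃ U ⊆ A, IsClosed U ∧ IsUpperSet U ∧ r < μ U := by
  obtain ⟨K, hKA, hK, hrK⟩ := hA.exists_lt_isCompact hr
  exact ⟨upperClosure K, upperClosure_min hKA hA',
    hK.isClosed.upperClosure_pi (isBounded_iff_bddBelow_bddAbove.1 hK.isBounded).1,
    (upperClosure K).upper, hrK.trans_le (measure_mono subset_upperClosure)⟩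

lemma measure_mul_measure_le_of_isUpperSet
    (h : ∀ {U V : Set (ι → ℝ)}, IsClosed U → IsClosed V → IsUpperSet U → IsUpperSet V →
      μ U * μ V ≤ μ (U ∩ V))
    {A B : Set (ι → ℝ)} (hA : MeasurableSet A) (hB : MeasurableSet B) (hA' : IsUpperSet A)
    (hB' : IsUpperSet B) : μ A * μ B ≤ μ (A ∩ B) := by
  refine ENNReal.mul_le_of_forall_lt fun r hr r' hr' => ?_
  obtain ⟨U, hUA, hU, hU', hrU⟩ := exists_isClosed_isUpperSet_lt hA hA' hr
  obtain ⟨V, hVB, hV, hV', hrV⟩ := exists_isClosed_isUpperSet_lt hB hB' hr'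
  calc r * r' ≤ μ U * μ V := by gcongr
    _ ≤ μ (U ∩ V) := h hU hV hU' hV'
    _ ≤ μ (A ∩ B) := by gcongr

/-- If `r * μ A ≤ ν A` for upper sets `A`, the same comparison holds for integrals of nonnegative
nondecreasing functions. -/
lemma mul_lintegral_le_of_monotone {α : Type*} [MeasurableSpace α] [Preorder α]
    {ρ ν : Measure α} {r : ENNReal}
    (h : ∀ A, MeasurableSet A → IsUpperSet A → r * ρ A ≤ ν A)
    {F : α → ℝ} (hF : Measurable F) (hmono : Monotone F) (h0 : ∀ x, 0 ≤ F x) :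
    r * ∫⁻ x, ENNReal.ofReal (F x) ∂ρ ≤ ∫⁻ x, ENNReal.ofReal (F x) ∂ν := by
  rw [lintegral_eq_lintegral_meas_lt ρ (.of_forall h0) hF.aemeasurable,
    lintegral_eq_lintegral_meas_lt ν (.of_forall h0) hF.aemeasurable,
    ← lintegral_const_mul]
  · refine lintegral_mono fun t => h _ (measurableSet_lt measurable_const hF) ?_
    exact fun x y hxy hx => lt_of_lt_of_le hx (hmono hxy)
  · refine Antitone.measurable fun s t hst => measure_mono fun x hx => lt_of_le_of_lt hst hx

lemma lintegral_mul_lintegral_le_of_monotone {α : Type*} [MeasurableSpace α] [Preorder α]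
    {ρ : Measure α}
    (h : ∀ A B, MeasurableSet A → MeasurableSet B → IsUpperSet A → IsUpperSet B →
      ρ A * ρ B ≤ ρ (A ∩ B))
    {F G : α → ℝ} (hF : Measurable F) (hG : Measurable G) (hFmono : Monotone F)
    (hGmono : Monotone G) (hF0 : ∀ x, 0 ≤ F x) (hG0 : ∀ x, 0 ≤ G x) :
    (∫⁻ x, ENNReal.ofReal (F x) ∂ρ) * (∫⁻ x, ENNReal.ofReal (G x) ∂ρ)
      ≤ ∫⁻ x, ENNReal.ofReal (F x) * ENNReal.ofReal (G x) ∂ρ := by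
  have key := mul_lintegral_le_of_monotone (ρ := ρ)
    (ν := ρ.withDensity fun x => ENNReal.ofReal (F x)) (r := ∫⁻ x, ENNReal.ofReal (F x) ∂ρ)
    (fun B hB hB' => by
      rw [withDensity_apply _ hB, mul_comm]
      refine mul_lintegral_le_of_monotone (fun A hA hA' => ?_) hF hFmono hF0
      rw [Measure.restrict_apply hA, mul_comm]
      exact h A B hA hB hA' hB') hG hGmono hG0
  rwa [lintegral_withDensity_eq_lintegral_mul _ hF.ennreal_ofReal hG.ennreal_ofReal] at key

lemma integral_mul_integral_le_of_monotone {α : Type*} [MeasurableSpace α] [Preorder α]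
    {ρ : Measure α} [IsProbabilityMeasure ρ]
    (h : ∀ A B, MeasurableSet A → MeasurableSet B → IsUpperSet A → IsUpperSet B →
      ρ A * ρ B ≤ ρ (A ∩ B))
    {F G : α → ℝ} (hF : Measurable F) (hG : Measurable G) (hFmono : Monotone F)
    (hGmono : Monotone G) {M N : ℝ} (hFM : ∀ x, |F x| ≤ M) (hGN : ∀ x, |G x| ≤ N) :
    (∫ x, F x ∂ρ) * (∫ x, G x ∂ρ) ≤ ∫ x, F x * G x ∂ρ := by
  have iF : Integrable F ρ := integrable_of_measurable_of_abs_le hF hFM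
  have iG : Integrable G ρ := integrable_of_measurable_of_abs_le hG hGN
  have iFG : Integrable (fun x => F x * G x) ρ := iF.mul_bdd (c := N)
    hG.aestronglyMeasurable (.of_forall hGN)
  have hF0 (x : α) : 0 ≤ F x - -M := by linarith [(abs_le.1 (hFM x)).1]
  have hG0 (x : α) : 0 ≤ G x - -N := by linarith [(abs_le.1 (hGN x)).1]
  rw [← sub_nonneg, ← integral_sub_const_mul_sub_const iF iG iFG (-M) (-N), sub_nonneg]
  have key := lintegral_mul_lintegral_le_of_monotone h (hF.sub_const (-M)) (hG.sub_const (-N))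
    (fun x y hxy => sub_le_sub_right (hFmono hxy) _)
    (fun x y hxy => sub_le_sub_right (hGmono hxy) _) hF0 hG0
  have iF' : Integrable (fun x => F x - -M) ρ := iF.sub (integrable_const _)
  have iG' : Integrable (fun x => G x - -N) ρ := iG.sub (integrable_const _)
  simp_rw [← ENNReal.ofReal_mul (hF0 _)] at key
  rw [← ofReal_integral_eq_lintegral_ofReal iF' (.of_forall hF0),
    ← ofReal_integral_eq_lintegral_ofReal iG' (.of_forall hG0),
    ← ofReal_integral_eq_lintegral_ofReal (integrable_sub_const_mul_sub_const iF iG iFG _ _)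
      (.of_forall fun x => mul_nonneg (hF0 x) (hG0 x)),
    ← ENNReal.ofReal_mul (integral_nonneg hF0)] at key
  exact (ENNReal.ofReal_le_ofReal_iff
    (integral_nonneg fun x => mul_nonneg (hF0 x) (hG0 x))).1 key
end

/-- A law all of whose linear functionals are centered Gaussian is the law of `c • (Y + Y')` for
independent copies `Y, Y'`, where `2 * c ^ 2 = 1`. -/
lemma map_smul_add_smul_prod_eq {E : Type*} [NormedAddCommGroup E] [NormedSpace ℝ E]
    [CompleteSpace E] [SecondCountableTopology E] [MeasurableSpace E] [BorelSpace E]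
    {μ : Measure E} [IsProbabilityMeasure μ]
    (hμ : ∀ L : StrongDual ℝ E, ∃ v : NNReal, μ.map L = gaussianReal 0 v) {c : ℝ}
    (hc : 2 * c ^ 2 = 1) :
    (μ.prod μ).map (fun p => c • p.1 + c • p.2) = μ := by
  have hmap : (μ.prod μ).map (fun p => c • p.1 + c • p.2)
      = ((μ.map (c • ·)).prod (μ.map (c • ·))).map (fun p => p.1 + p.2) := by
    rw [Measure.map_prod_map _ _ (by fun_prop) (by fun_prop),
      Measure.map_map (by fun_prop) (by fun_prop)]
    rfl
  have : IsProbabilityMeasure (μ.map (c • · : E → E)) :=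
    Measure.isProbabilityMeasure_map (by fun_prop)
  refine Measure.ext_of_charFunDual ?_
  rw [hmap, charFunDual_map_add_prod_eq_mul]
  ext L
  obtain ⟨v, hv⟩ := hμ L
  have h1 : charFunDual μ L = Complex.exp (- (v / 2)) := by
    rw [charFunDual_eq_charFun_map_one, hv, charFun_gaussianReal]
    simp
  have h2 : charFunDual (μ.map (c • ·)) L = Complex.exp (- (v * c ^ 2 / 2)) := by
    rw [charFunDual_eq_charFun_map_one, Measure.map_map (by fun_prop) (by fun_prop)]
    have e : (L ∘ fun x => c • x) = (c * ·) ∘ L := by ext; simp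
    rw [e, ← Measure.map_map (by fun_prop) (by fun_prop), hv, charFun_map_mul,
      charFun_gaussianReal]
    simp
  have hc' : 2 * (c : ℂ) ^ 2 = 1 := by exact_mod_cast hc
  rw [Pi.mul_apply, h1, h2, ← Complex.exp_add]
  congr 1
  linear_combination (- (v : ℂ) / 2) * hc'

/-- Pitt's FKG inequality for positively correlated Gaussian vectors:
if `φ` is a centered Gaussian vector in `ℝ^k` (every linear functional of `φ` is a centered
Gaussian) whose covariance has all entries nonnegative, then for bounded, coordinatewise
nondecreasing, measurable `F, G`, `E[F(φ)G(φ)] ≥ E[F(φ)] E[G(φ)]`; in particular for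
increasing events `A, B`, `P[φ ∈ A ∩ B] ≥ P[φ ∈ A] P[φ ∈ B]`. -/
theorem pitt_fkg {Ω : Type*} [MeasureSpace Ω] [IsProbabilityMeasure (ℙ : Measure Ω)]
    (k : ℕ) (φ : Ω → Fin k → ℝ) (hmeas : Measurable φ)
    (hGauss : ∀ L : (Fin k → ℝ) →ₗ[ℝ] ℝ, ∃ v : NNReal,
      Measure.map (fun ω => L (φ ω)) ℙ = gaussianReal 0 v)
    (hcentered : ∀ i, (∫ ω, φ ω i) = 0)
    (hcov : ∀ i j, 0 ≤ ∫ ω, φ ω i * φ ω j) :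
    (∀ F G : (Fin k → ℝ) → ℝ, Measurable F → Measurable G →
      (∃ M, ∀ x, |F x| ≤ M) → (∃ M, ∀ x, |G x| ≤ M) →
      Monotone F → Monotone G →
      (∫ ω, F (φ ω)) * (∫ ω, G (φ ω)) ≤ ∫ ω, F (φ ω) * G (φ ω)) ∧
    (∀ A B : Set (Fin k → ℝ), MeasurableSet A → MeasurableSet B →
      (∀ x y, x ≤ y → x ∈ A → y ∈ A) → (∀ x y, x ≤ y → x ∈ B → y ∈ B) →
      ℙ (φ ⁻¹' A) * ℙ (φ ⁻¹' B) ≤ ℙ (φ ⁻¹' A ∩ φ ⁻¹' B)) := by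
  have hL (L : StrongDual ℝ (Fin k → ℝ)) :
      ∃ v : NNReal, (Measure.map φ ℙ).map L = gaussianReal 0 v := by
    rw [Measure.map_map (by fun_prop) hmeas]
    exact hGauss L
  have : IsProbabilityMeasure (Measure.map φ ℙ) :=
    Measure.isProbabilityMeasure_map hmeas.aemeasurable
  have : IsGaussian (Measure.map φ ℙ) :=
    isGaussian_of_map_eq_gaussianReal fun L => ⟨0, hL L⟩
  have h4 : Integrable (fun y => ‖y‖ ^ 4) (Measure.map φ ℙ) := by
    simpa using (IsGaussian.memLp_id (Measure.map φ ℙ) 4 (by simp)).integrable_norm_pow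
      (p := 4) (by norm_num)
  have hc : 2 * (√(1 / 2)) ^ 2 = (1 : ℝ) := by
    rw [Real.sq_sqrt (by norm_num)]
    norm_num
  have hcent (i : Fin k) : ∫ y, y i ∂(Measure.map φ ℙ) = 0 := by
    rw [integral_map hmeas.aemeasurable (measurable_pi_apply i).aestronglyMeasurable]
    exact hcentered i
  have hcov' (i j : Fin k) : 0 ≤ ∫ y, y i * y j ∂(Measure.map φ ℙ) := by
    rw [integral_map (f := fun y : Fin k → ℝ => y i * y j) hmeas.aemeasurable
      (Measurable.aestronglyMeasurable (by fun_prop))]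
    exact hcov i j
  have hsets (A B : Set (Fin k → ℝ)) (hA : MeasurableSet A) (hB : MeasurableSet B)
      (hA' : IsUpperSet A) (hB' : IsUpperSet B) :
      Measure.map φ ℙ A * Measure.map φ ℙ B ≤ Measure.map φ ℙ (A ∩ B) :=
    measure_mul_measure_le_of_isUpperSet
      (measure_mul_measure_le_of_isClosed fun hF hG hFmono hGmono _ hFM hGM =>
        integral_mul_integral_le_of_lipschitzWith
          (fun hK _ _ _ _ ha hb => ha.integral_mul_integral_le (Real.sqrt_nonneg _) hc
            (map_smul_add_smul_prod_eq hL hc) h4 hcent hcov' hK hb)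
          hF hG hFmono hGmono hFM hGM)
      hA hB hA' hB'
  refine ⟨?_, fun A B hA hB hA' hB' => ?_⟩
  · rintro F G hF hG ⟨M, hM⟩ ⟨N, hN⟩ hFmono hGmono
    have := integral_mul_integral_le_of_monotone hsets hF hG hFmono hGmono hM hN
    rwa [integral_map hmeas.aemeasurable hF.aestronglyMeasurable,
      integral_map hmeas.aemeasurable hG.aestronglyMeasurable,
      integral_map (f := fun y => F y * G y) hmeas.aemeasurable
        (hF.mul hG).aestronglyMeasurable] at this
  · have := hsets A B hA hB (fun x y => hA' x y) (fun x y => hB' x y)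
    rwa [Measure.map_apply hmeas hA, Measure.map_apply hmeas hB,
      Measure.map_apply hmeas (hA.inter hB), Set.preimage_inter] at this
end

section
/- Let k ≥ λ > 0, U ⊆ ℝ² open, and f : ℝ² → ℝ a C² function with ‖df‖_{C¹(U)} ≤ k. Suppose x ∈ ℝ² satisfies f(x) = 0 and |∂₂f(x)| ≥ λ/√2, and set ε = (λ/(4k))². Then on the box b[x,ε] the zero set of f is the graph {(t, φ(t))} of a C² function φ defined on the interval I_ε = {t : |t − x₁| < ε}, and moreover ‖φ''‖_{L^∞(I_ε)} ≤ 100 (k/λ)³. -/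
open Set

open scoped Topology

/-- The value, first and second derivative of a function at a point. -/
noncomputable def secondJet (f : ℝ × ℝ → ℝ) (z : ℝ × ℝ) :
    ℝ × (ℝ × ℝ →L[ℝ] ℝ) × (ℝ × ℝ →L[ℝ] ℝ × ℝ →L[ℝ] ℝ) :=
  (f z, fderiv ℝ f z, fderiv ℝ (fderiv ℝ f) z)

lemma hasFDerivAt_ite_snd_le {E : Type*} [NormedAddCommGroup E] [NormedSpace ℝ E]
    {A B : ℝ × ℝ → E} {z : ℝ × ℝ} {c : ℝ}
    (hA : DifferentiableAt ℝ A z) (hB : DifferentiableAt ℝ B z)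
    (hAB : ∀ᶠ w in 𝓝 z, w.2 = c → A w = B w)
    (hAB' : z.2 = c → fderiv ℝ A z = fderiv ℝ B z) :
    HasFDerivAt (fun w => if w.2 ≤ c then A w else B w)
      (if z.2 ≤ c then fderiv ℝ A z else fderiv ℝ B z) z := by
  rcases lt_trichotomy z.2 c with h | h | h
  · rw [if_pos h.le]
    refine hA.hasFDerivAt.congr_of_eventuallyEq ?_
    filter_upwards [(isOpen_lt continuous_snd continuous_const).mem_nhds h] with w hw
    exact if_pos (le_of_lt hw)
  · rw [if_pos h.le]
    have h1 : HasFDerivWithinAt (fun w => if w.2 ≤ c then A w else B w) (fderiv ℝ A z)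
        {w : ℝ × ℝ | w.2 ≤ c} z :=
      hA.hasFDerivAt.hasFDerivWithinAt.congr (fun w hw => if_pos hw) (if_pos h.le)
    have h2 : HasFDerivWithinAt (fun w => if w.2 ≤ c then A w else B w) (fderiv ℝ A z)
        {w : ℝ × ℝ | c ≤ w.2} z := by
      rw [hAB' h]
      refine hB.hasFDerivAt.hasFDerivWithinAt.congr_of_eventuallyEq ?_ ?_
      · filter_upwards [nhdsWithin_le_nhds hAB, self_mem_nhdsWithin] with w hw hw'
        split_ifs with hc
        · exact hw (le_antisymm hc hw')
        · rfl
      · rw [if_pos h.le]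
        exact hAB.self_of_nhds h
    have h3 := h1.union h2
    rw [← hasFDerivWithinAt_univ]
    convert! h3 using 1
    ext w
    simp [le_total]
  · rw [if_neg h.not_ge]
    refine hB.hasFDerivAt.congr_of_eventuallyEq ?_
    filter_upwards [(isOpen_lt continuous_const continuous_snd).mem_nhds h] with w hw
    exact if_neg (not_le_of_gt hw)

lemma contDiffOn_ite_snd_le {A B : ℝ × ℝ → ℝ} {S : Set (ℝ × ℝ)} {c : ℝ} (hS : IsOpen S)
    (hA : ContDiffOn ℝ 2 A S) (hB : ContDiffOn ℝ 2 B S)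
    (hAB : ∀ z ∈ S, z.2 = c → secondJet A z = secondJet B z) :
    ContDiffOn ℝ 2 (fun w => if w.2 ≤ c then A w else B w) S ∧
      ∀ z ∈ S, secondJet (fun w => if w.2 ≤ c then A w else B w) z =
        if z.2 ≤ c then secondJet A z else secondJet B z := by
  simp only [secondJet, Prod.mk.injEq] at hAB
  rw [show (2 : WithTop ℕ∞) = 1 + 1 by norm_num, contDiffOn_succ_iff_fderiv_of_isOpen hS] at hA hB
  obtain ⟨hA0, -, hA1⟩ := hA
  obtain ⟨hB0, -, hB1⟩ := hB
  have hA2 := (contDiffOn_succ_iff_fderiv_of_isOpen (n := 0) hS).1 hA1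
  have hB2 := (contDiffOn_succ_iff_fderiv_of_isOpen (n := 0) hS).1 hB1
  have key : ∀ z ∈ S, HasFDerivAt (fun w => if w.2 ≤ c then A w else B w)
      (if z.2 ≤ c then fderiv ℝ A z else fderiv ℝ B z) z := fun z hz =>
    hasFDerivAt_ite_snd_le (hA0.differentiableAt (hS.mem_nhds hz))
      (hB0.differentiableAt (hS.mem_nhds hz))
      (Filter.mem_of_superset (hS.mem_nhds hz) fun w hw h => (hAB w hw h).1)
      fun h => (hAB z hz h).2.1
  have key2 : ∀ z ∈ S, HasFDerivAt
      (fun w => if w.2 ≤ c then fderiv ℝ A w else fderiv ℝ B w)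
      (if z.2 ≤ c then fderiv ℝ (fderiv ℝ A) z else fderiv ℝ (fderiv ℝ B) z) z := fun z hz =>
    hasFDerivAt_ite_snd_le (hA2.1.differentiableAt (hS.mem_nhds hz))
      (hB2.1.differentiableAt (hS.mem_nhds hz))
      (Filter.mem_of_superset (hS.mem_nhds hz) fun w hw h => (hAB w hw h).2.1)
      fun h => (hAB z hz h).2.2
  have hev : ∀ z ∈ S, fderiv ℝ (fun w => if w.2 ≤ c then A w else B w) =ᶠ[𝓝 z]
      (fun w => if w.2 ≤ c then fderiv ℝ A w else fderiv ℝ B w) := fun z hz => by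
    filter_upwards [hS.mem_nhds hz] with w hw using (key w hw).fderiv
  have key3 : ∀ z ∈ S, HasFDerivAt (fderiv ℝ (fun w => if w.2 ≤ c then A w else B w))
      (if z.2 ≤ c then fderiv ℝ (fderiv ℝ A) z else fderiv ℝ (fderiv ℝ B) z) z :=
    fun z hz => (key2 z hz).congr_of_eventuallyEq (hev z hz)
  constructor
  · rw [show (2 : WithTop ℕ∞) = 0 + 1 + 1 by norm_num, contDiffOn_succ_iff_fderiv_of_isOpen hS,
      contDiffOn_succ_iff_fderiv_of_isOpen hS, contDiffOn_zero]
    refine ⟨fun z hz => (key z hz).differentiableAt.differentiableWithinAt, by simp,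
      fun z hz => (key3 z hz).differentiableAt.differentiableWithinAt, by simp, ?_⟩
    have hc : ContinuousOn (fun z : ℝ × ℝ => if z.2 ≤ c then fderiv ℝ (fderiv ℝ A) z
        else fderiv ℝ (fderiv ℝ B) z) S := by
      have hcl : closure {z : ℝ × ℝ | ¬ z.2 ≤ c} ⊆ {z | c ≤ z.2} :=
        closure_minimal (fun z hz => (not_le.1 hz).le)
          (isClosed_le continuous_const continuous_snd)
      refine ContinuousOn.if (fun z hz => (hAB z hz.1 ?_).2.2) ?_ ?_
      · exact frontier_le_subset_eq continuous_snd continuous_const hz.2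
      · exact (contDiffOn_zero.1 hA2.2.2).mono inter_subset_left
      · exact (contDiffOn_zero.1 hB2.2.2).mono inter_subset_left
    exact hc.congr fun z hz => (key3 z hz).fderiv
  · intro z hz
    simp only [secondJet]
    rw [(key z hz).fderiv, (key3 z hz).fderiv]
    split_ifs <;> rfl

lemma fderiv_apply_fst_eq_zero {E : Type*} [NormedAddCommGroup E] [NormedSpace ℝ E]
    {g : ℝ × ℝ → E} {t c : ℝ} (hg : DifferentiableAt ℝ g (t, c))
    (h : ∀ᶠ s in 𝓝 t, g (s, c) = 0) : fderiv ℝ g (t, c) (1, 0) = 0 := by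
  have h1 : HasDerivAt (fun s : ℝ => (s, c)) ((1 : ℝ), (0 : ℝ)) t :=
    (hasDerivAt_id t).prodMk (hasDerivAt_const t c)
  have h2 := hg.hasFDerivAt.comp_hasDerivAt t h1
  have h3 : HasDerivAt (g ∘ fun s : ℝ => (s, c)) 0 t :=
    (hasDerivAt_const t (0 : E)).congr_of_eventuallyEq h
  exact h2.unique h3

lemma secondJet_eq_zero {D : ℝ × ℝ → ℝ} {a b c : ℝ} (hD : ContDiff ℝ 2 D)
    (h0 : ∀ t ∈ Ioo a b, D (t, c) = 0)
    (h1 : ∀ t ∈ Ioo a b, fderiv ℝ D (t, c) (0, 1) = 0)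
    (h2 : ∀ t ∈ Ioo a b, fderiv ℝ (fderiv ℝ D) (t, c) (0, 1) (0, 1) = 0) :
    ∀ t ∈ Ioo a b, secondJet D (t, c) = 0 := by
  have hD1 : Differentiable ℝ D := hD.differentiable (by norm_num)
  have hD2 : Differentiable ℝ (fderiv ℝ D) :=
    (hD.fderiv_right (m := 1) (by norm_num)).differentiable (by norm_num)
  have hlin : ∀ (E : Type) [NormedAddCommGroup E] [NormedSpace ℝ E] (l : ℝ × ℝ →L[ℝ] E),
      l (1, 0) = 0 → l (0, 1) = 0 → l = 0 := fun E _ _ l ha hb => by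
    ext <;> simp [ha, hb]
  have hf : ∀ t ∈ Ioo a b, fderiv ℝ D (t, c) = 0 := fun t ht =>
    hlin _ _ (fderiv_apply_fst_eq_zero (hD1 _)
      (Filter.mem_of_superset (Ioo_mem_nhds ht.1 ht.2) h0)) (h1 t ht)
  intro t ht
  have hd1 : fderiv ℝ (fderiv ℝ D) (t, c) (1, 0) = 0 := fderiv_apply_fst_eq_zero (hD2 _)
      (Filter.mem_of_superset (Ioo_mem_nhds ht.1 ht.2) hf)
  have hsymm : IsSymmSndFDerivAt ℝ D (t, c) := hD.contDiffAt.isSymmSndFDerivAt (by simp)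
  have hd2 : fderiv ℝ (fderiv ℝ D) (t, c) (0, 1) = 0 :=
    hlin _ _ (by rw [hsymm.eq, hd1]; rfl) (h2 t ht)
  simp only [secondJet, h0 t ht, hf t ht, hlin _ _ hd1 hd2]
  rfl

lemma exists_contDiffOn_root {a b y₀ R : ℝ} {F : ℝ × ℝ → ℝ} (hR : 0 ≤ R)
    (hF : ContDiffOn ℝ 2 F (Ioo a b ×ˢ univ))
    (hpos : ∀ t ∈ Ioo a b, ∀ y, |y - y₀| ≤ R → 0 < fderiv ℝ F (t, y) (0, 1))
    (hlo : ∀ t ∈ Ioo a b, F (t, y₀ - R) < 0) (hhi : ∀ t ∈ Ioo a b, 0 < F (t, y₀ + R)) :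
    ∃ φ : ℝ → ℝ, ContDiffOn ℝ 2 φ (Ioo a b) ∧ ∀ t ∈ Ioo a b, |φ t - y₀| ≤ R ∧
      ∀ y, |y - y₀| ≤ R → (F (t, y) = 0 ↔ y = φ t) := by
  have hS : IsOpen (Ioo a b ×ˢ (univ : Set ℝ)) := isOpen_Ioo.prod isOpen_univ
  have hFat : ∀ t ∈ Ioo a b, ∀ y, ContDiffAt ℝ 2 F (t, y) := fun t ht y =>
    hF.contDiffAt (hS.mem_nhds ⟨ht, mem_univ _⟩)
  have hd : ∀ t ∈ Ioo a b, ∀ y, HasDerivAt (fun y => F (t, y)) (fderiv ℝ F (t, y) (0, 1)) y :=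
    fun t ht y => ((hFat t ht y).differentiableAt (by norm_num)).hasFDerivAt.comp_hasDerivAt y
      ((hasDerivAt_const y t).prodMk (hasDerivAt_id y))
  have hmono : ∀ t ∈ Ioo a b, StrictMonoOn (fun y => F (t, y)) (Icc (y₀ - R) (y₀ + R)) := by
    intro t ht
    refine strictMonoOn_of_deriv_pos (convex_Icc _ _)
      (fun y _ => (hd t ht y).continuousAt.continuousWithinAt) fun y hy => ?_
    rw [interior_Icc] at hy
    rw [(hd t ht y).deriv]
    exact hpos t ht y (abs_le.2 ⟨by linarith [hy.1], by linarith [hy.2]⟩)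
  have hmem : ∀ y, |y - y₀| ≤ R ↔ y ∈ Icc (y₀ - R) (y₀ + R) := fun y => by
    rw [abs_le, mem_Icc]
    constructor <;> rintro ⟨h1, h2⟩ <;> constructor <;> linarith
  have hex : ∀ t ∈ Ioo a b, ∃ y, y ∈ Ioo (y₀ - R) (y₀ + R) ∧ F (t, y) = 0 := by
    intro t ht
    exact intermediate_value_Ioo (by linarith : y₀ - R ≤ y₀ + R)
      (fun y _ => (hd t ht y).continuousAt.continuousWithinAt) ⟨hlo t ht, hhi t ht⟩
  choose! φ hφ hφ0 using hex
  have huniq : ∀ t ∈ Ioo a b, ∀ y, |y - y₀| ≤ R → (F (t, y) = 0 ↔ y = φ t) := by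
    intro t ht y hy
    constructor
    · intro h
      exact (hmono t ht).injOn ((hmem y).1 hy) (Ioo_subset_Icc_self (hφ t ht))
        (by simp only [h, hφ0 t ht])
    · rintro rfl
      exact hφ0 t ht
  refine ⟨φ, fun t ht => ContDiffAt.contDiffWithinAt ?_,
    fun t ht => ⟨(hmem _).2 (Ioo_subset_Icc_self (hφ t ht)), huniq t ht⟩⟩
  have hy : |φ t - y₀| ≤ R := (hmem _).2 (Ioo_subset_Icc_self (hφ t ht))
  have hinv : (fderiv ℝ F (t, φ t) ∘L .inr ℝ ℝ ℝ).IsInvertible := by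
    have hne := (hpos t ht (φ t) hy).ne'
    refine ⟨ContinuousLinearEquiv.unitsEquivAut ℝ (Units.mk0 _ hne), ?_⟩
    ext
    simp
  have hcd := hFat t ht (φ t)
  set ψ := hcd.implicitFunction two_ne_zero hinv with hψ
  have hψc : ContDiffAt ℝ 2 ψ t := hcd.contDiffAt_implicitFunction two_ne_zero hinv
  have hψt : ψ t = φ t := hcd.implicitFunction_apply_self two_ne_zero hinv
  have hψ0 : ∀ᶠ s in 𝓝 t, F (s, ψ s) = F (t, φ t) :=
    hcd.eventually_apply_implicitFunction two_ne_zero hinv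
  refine hψc.congr_of_eventuallyEq ?_
  have hψm : ∀ᶠ s in 𝓝 t, ψ s ∈ Ioo (y₀ - R) (y₀ + R) :=
    hψc.continuousAt (Ioo_mem_nhds (by rw [hψt]; exact (hφ t ht).1)
      (by rw [hψt]; exact (hφ t ht).2))
  filter_upwards [hψ0, hψm, Ioo_mem_nhds ht.1 ht.2] with s h1 h2 h3
  refine ((huniq s h3 (ψ s) ((hmem _).2 (Ioo_subset_Icc_self h2))).1 ?_).symm
  rw [h1, hφ0 t ht]

lemma deriv_implicit_eq {a b : ℝ} {F : ℝ × ℝ → ℝ} {φ : ℝ → ℝ}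
    (hF : ContDiffOn ℝ 2 F (Ioo a b ×ˢ univ)) (hφ : ContDiffOn ℝ 2 φ (Ioo a b))
    (h0 : ∀ t ∈ Ioo a b, F (t, φ t) = 0) {t : ℝ} (ht : t ∈ Ioo a b) :
    fderiv ℝ F (t, φ t) (1, deriv φ t) = 0 ∧
      fderiv ℝ (fderiv ℝ F) (t, φ t) (1, deriv φ t) (1, deriv φ t) +
        deriv (deriv φ) t * fderiv ℝ F (t, φ t) (0, 1) = 0 := by
  have hS : IsOpen (Ioo a b ×ˢ (univ : Set ℝ)) := isOpen_Ioo.prod isOpen_univ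
  have hFat : ∀ t ∈ Ioo a b, ∀ y, ContDiffAt ℝ 2 F (t, y) := fun t ht y =>
    hF.contDiffAt (hS.mem_nhds ⟨ht, mem_univ _⟩)
  have hφat : ∀ t ∈ Ioo a b, ContDiffAt ℝ 2 φ t := fun t ht =>
    hφ.contDiffAt (Ioo_mem_nhds ht.1 ht.2)
  have hγ : ∀ s ∈ Ioo a b, HasDerivAt (fun s => (s, φ s)) ((1 : ℝ), deriv φ s) s := fun s hs =>
    (hasDerivAt_id s).prodMk ((hφat s hs).differentiableAt (by norm_num)).hasDerivAt
  have h1 : ∀ s ∈ Ioo a b, fderiv ℝ F (s, φ s) (1, deriv φ s) = 0 := by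
    intro s hs
    have h : HasDerivAt (fun s => F (s, φ s)) (fderiv ℝ F (s, φ s) (1, deriv φ s)) s :=
      ((hFat s hs (φ s)).differentiableAt (by norm_num)).hasFDerivAt.comp_hasDerivAt s (hγ s hs)
    exact h.unique ((hasDerivAt_const s (0 : ℝ)).congr_of_eventuallyEq
      (Filter.mem_of_superset (Ioo_mem_nhds hs.1 hs.2) h0))
  refine ⟨h1 t ht, ?_⟩
  have hφ' : DifferentiableAt ℝ (deriv φ) t := by
    have := ((contDiffOn_succ_iff_deriv_of_isOpen (n := 1) isOpen_Ioo).1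
      (by simpa [one_add_one_eq_two] using hφ)).2.2
    exact (this.contDiffAt (Ioo_mem_nhds ht.1 ht.2)).differentiableAt (by norm_num)
  have hF' : DifferentiableAt ℝ (fderiv ℝ F) (t, φ t) :=
    ((hFat t ht (φ t)).fderiv_right (m := 1) (by norm_num)).differentiableAt (by norm_num)
  have h2 : HasDerivAt (fun s => fderiv ℝ F (s, φ s))
      (fderiv ℝ (fderiv ℝ F) (t, φ t) (1, deriv φ t)) t :=
    hF'.hasFDerivAt.comp_hasDerivAt t (hγ t ht)
  have h3 : HasDerivAt (fun s => ((1 : ℝ), deriv φ s)) ((0 : ℝ), deriv (deriv φ) t) t :=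
    (hasDerivAt_const t (1 : ℝ)).prodMk hφ'.hasDerivAt
  have h4 := (h2.clm_apply h3).unique ((hasDerivAt_const t (0 : ℝ)).congr_of_eventuallyEq
      (Filter.mem_of_superset (Ioo_mem_nhds ht.1 ht.2) h1))
  rw [show ((0 : ℝ), deriv (deriv φ) t) = deriv (deriv φ) t • ((0 : ℝ), (1 : ℝ)) by simp,
    map_smul, smul_eq_mul] at h4
  exact h4

lemma exists_deriv_hasDerivAt {β : ℝ → ℝ} (hβ : Continuous β) (x₀ p₀ : ℝ) :
    ∃ G : ℝ → ℝ, ContDiff ℝ 2 G ∧ deriv G x₀ = p₀ ∧ ∀ u, HasDerivAt (deriv G) (β u) u := by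
  have h1 : ∀ u, HasDerivAt (fun u => p₀ + ∫ v in x₀..u, β v) (β u) u := fun u =>
    (hβ.integral_hasStrictDerivAt x₀ u).hasDerivAt.const_add p₀
  have hc : Continuous (fun u => p₀ + ∫ v in x₀..u, β v) :=
    continuous_iff_continuousAt.2 fun u => (h1 u).continuousAt
  have h2 : ∀ u, HasDerivAt (fun u => ∫ w in x₀..u, (p₀ + ∫ v in x₀..w, β v))
      (p₀ + ∫ v in x₀..u, β v) u := fun u => (hc.integral_hasStrictDerivAt x₀ u).hasDerivAt
  have h3 : deriv (fun u => ∫ w in x₀..u, (p₀ + ∫ v in x₀..w, β v)) =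
      fun u => p₀ + ∫ v in x₀..u, β v := funext fun u => (h2 u).deriv
  refine ⟨fun u => ∫ w in x₀..u, (p₀ + ∫ v in x₀..w, β v), ?_, ?_, fun u => ?_⟩
  · rw [show (2 : WithTop ℕ∞) = 1 + 1 by norm_num, contDiff_succ_iff_deriv, h3,
      contDiff_one_iff_deriv]
    refine ⟨fun u => (h2 u).differentiableAt, by simp, fun u => (h1 u).differentiableAt, ?_⟩
    rwa [show deriv (fun u => p₀ + ∫ v in x₀..u, β v) = β from funext fun u => (h1 u).deriv]
  · rw [h3]; simp
  · rw [h3]; exact h1 u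

lemma abs_sub_le_of_hasDerivAt {g β : ℝ → ℝ} {k : ℝ} (hg : ∀ u, HasDerivAt g (β u) u)
    (hβ : ∀ u, |β u| ≤ k) (u v : ℝ) : |g v - g u| ≤ k * |v - u| :=
  convex_univ.norm_image_sub_le_of_norm_hasDerivWithin_le
    (fun w _ => (hg w).hasDerivWithinAt) (fun w _ => hβ w) (mem_univ u) (mem_univ v)

/-- Extension of `f` off the line `{z | z.2 = c}` by travelling waves: it has the values of `f` on
that line, and its remaining Cauchy data there are governed by `deriv G - deriv H` and by the sum
of the second derivatives of `G` and `H`. -/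
noncomputable def waveExtension (f : ℝ × ℝ → ℝ) (G H : ℝ → ℝ) (c : ℝ) (z : ℝ × ℝ) : ℝ :=
  f (z.1, c) + G (z.1 + (z.2 - c)) + H (z.1 - (z.2 - c)) - (G z.1 + H z.1)

section waveExtension

variable {f : ℝ × ℝ → ℝ} {G H β γ : ℝ → ℝ} (c : ℝ)

lemma contDiff_waveExtension (hf : ContDiff ℝ 2 f) (hG : ContDiff ℝ 2 G) (hH : ContDiff ℝ 2 H) :
    ContDiff ℝ 2 (waveExtension f G H c) := by
  unfold waveExtension
  fun_prop

lemma hasFDerivAt_waveExtension (hf : ContDiff ℝ 2 f) (hG : ContDiff ℝ 2 G)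
    (hH : ContDiff ℝ 2 H) (z : ℝ × ℝ) :
    HasFDerivAt (waveExtension f G H c)
      ((fderiv ℝ f (z.1, c)).comp ((ContinuousLinearMap.fst ℝ ℝ ℝ).prod 0) +
        deriv G (z.1 + (z.2 - c)) •
          (ContinuousLinearMap.fst ℝ ℝ ℝ + ContinuousLinearMap.snd ℝ ℝ ℝ) +
        deriv H (z.1 - (z.2 - c)) •
          (ContinuousLinearMap.fst ℝ ℝ ℝ - ContinuousLinearMap.snd ℝ ℝ ℝ) -
        (deriv G z.1 • ContinuousLinearMap.fst ℝ ℝ ℝ +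
          deriv H z.1 • ContinuousLinearMap.fst ℝ ℝ ℝ)) z := by
  have h1 : HasFDerivAt (fun z : ℝ × ℝ => z.1) (ContinuousLinearMap.fst ℝ ℝ ℝ) z := hasFDerivAt_fst
  have h2 : HasFDerivAt (fun z : ℝ × ℝ => z.2 - c) (ContinuousLinearMap.snd ℝ ℝ ℝ) z :=
    hasFDerivAt_snd.sub_const c
  have hf' := (hf.differentiable (by norm_num) (z.1, c)).hasFDerivAt
  have hG' : ∀ u, HasDerivAt G (deriv G u) u := fun u =>
    (hG.differentiable (by norm_num) u).hasDerivAt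
  have hH' : ∀ u, HasDerivAt H (deriv H u) u := fun u =>
    (hH.differentiable (by norm_num) u).hasDerivAt
  have hline : HasFDerivAt (fun z : ℝ × ℝ => (z.1, c))
      ((ContinuousLinearMap.fst ℝ ℝ ℝ).prod 0) z := h1.prodMk (hasFDerivAt_const c z)
  exact (((hf'.comp z hline).add ((hG' _).comp_hasFDerivAt z (h1.add h2))).add
    ((hH' _).comp_hasFDerivAt z (h1.sub h2))).sub
      (((hG' _).comp_hasFDerivAt z h1).add ((hH' _).comp_hasFDerivAt z h1))

lemma fderiv_waveExtension_apply (hf : ContDiff ℝ 2 f) (hG : ContDiff ℝ 2 G)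
    (hH : ContDiff ℝ 2 H) (z v : ℝ × ℝ) :
    fderiv ℝ (waveExtension f G H c) z v = fderiv ℝ f (z.1, c) (v.1, 0) +
      deriv G (z.1 + (z.2 - c)) * (v.1 + v.2) + deriv H (z.1 - (z.2 - c)) * (v.1 - v.2) -
      (deriv G z.1 + deriv H z.1) * v.1 := by
  rw [(hasFDerivAt_waveExtension c hf hG hH z).fderiv]
  simp
  ring

lemma fderiv_fderiv_waveExtension_apply (hf : ContDiff ℝ 2 f) (hG : ContDiff ℝ 2 G)
    (hH : ContDiff ℝ 2 H) (hβ : ∀ u, HasDerivAt (deriv G) (β u) u)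
    (hγ : ∀ u, HasDerivAt (deriv H) (γ u) u) (z v : ℝ × ℝ) :
    fderiv ℝ (fderiv ℝ (waveExtension f G H c)) z v v =
      fderiv ℝ (fderiv ℝ f) (z.1, c) (v.1, 0) (v.1, 0) +
      β (z.1 + (z.2 - c)) * (v.1 + v.2) ^ 2 + γ (z.1 - (z.2 - c)) * (v.1 - v.2) ^ 2 -
      (β z.1 + γ z.1) * v.1 ^ 2 := by
  have hd : DifferentiableAt ℝ (fderiv ℝ (waveExtension f G H c)) z :=
    ((contDiff_waveExtension c hf hG hH).fderiv_right (m := 1) (by norm_num)).differentiable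
      (by norm_num) z
  have h1 : HasFDerivAt (fun w => fderiv ℝ (waveExtension f G H c) w v)
      ((fderiv ℝ (fderiv ℝ (waveExtension f G H c)) z).flip v) z := by
    simpa using hd.hasFDerivAt.clm_apply (hasFDerivAt_const v z)
  have hf1 : DifferentiableAt ℝ (fderiv ℝ f) (z.1, c) :=
    (hf.fderiv_right (m := 1) (by norm_num)).differentiable (by norm_num) _
  have hx : HasDerivAt (fun s : ℝ => z.1 + s * v.1) v.1 0 := by
    simpa using ((hasDerivAt_id (0 : ℝ)).mul_const v.1).const_add z.1
  have hy : HasDerivAt (fun s : ℝ => z.2 + s * v.2 - c) v.2 0 := by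
    simpa using (((hasDerivAt_id (0 : ℝ)).mul_const v.2).const_add z.2).sub_const c
  have hcurve : HasDerivAt (fun s : ℝ => z + s • v) v 0 := by
    simpa using ((hasDerivAt_id (0 : ℝ)).smul_const v).const_add z
  have h2 : HasDerivAt (fun s : ℝ => fderiv ℝ (waveExtension f G H c) (z + s • v) v)
      (fderiv ℝ (fderiv ℝ (waveExtension f G H c)) z v v) 0 := by
    have h1' : HasFDerivAt (fun w => fderiv ℝ (waveExtension f G H c) w v)
      ((fderiv ℝ (fderiv ℝ (waveExtension f G H c)) z).flip v) (z + (0 : ℝ) • v) := by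
      simpa using h1
    exact h1'.comp_hasDerivAt (0 : ℝ) hcurve
  have e1 : HasDerivAt (fun s : ℝ => fderiv ℝ f (z.1 + s * v.1, c) (v.1, 0))
      (fderiv ℝ (fderiv ℝ f) (z.1, c) (v.1, 0) (v.1, 0)) 0 := by
    have hf2 : HasFDerivAt (fderiv ℝ f) (fderiv ℝ (fderiv ℝ f) (z.1, c))
      (z.1 + (0 : ℝ) * v.1, c) := by simpa using hf1.hasFDerivAt
    have h3 : HasDerivAt (fun s : ℝ => fderiv ℝ f (z.1 + s * v.1, c))
      (fderiv ℝ (fderiv ℝ f) (z.1, c) (v.1, 0)) 0 :=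
      hf2.comp_hasDerivAt (0 : ℝ) (hx.prodMk (hasDerivAt_const (0 : ℝ) c))
    simpa using h3.clm_apply (hasDerivAt_const (0 : ℝ) (v.1, (0 : ℝ)))
  have e2 : HasDerivAt (fun s : ℝ => deriv G (z.1 + s * v.1 + (z.2 + s * v.2 - c)))
      (β (z.1 + (z.2 - c)) * (v.1 + v.2)) 0 := by
    refine HasDerivAt.comp (0 : ℝ) (h₂ := deriv G) ?_ (hx.add hy)
    simpa using hβ (z.1 + (z.2 - c))
  have e3 : HasDerivAt (fun s : ℝ => deriv H (z.1 + s * v.1 - (z.2 + s * v.2 - c)))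
      (γ (z.1 - (z.2 - c)) * (v.1 - v.2)) 0 := by
    refine HasDerivAt.comp (0 : ℝ) (h₂ := deriv H) ?_ (hx.sub hy)
    simpa using hγ (z.1 - (z.2 - c))
  have e4 : HasDerivAt (fun s : ℝ => deriv G (z.1 + s * v.1)) (β z.1 * v.1) 0 := by
    refine HasDerivAt.comp (0 : ℝ) (h₂ := deriv G) ?_ hx
    simpa using hβ z.1
  have e5 : HasDerivAt (fun s : ℝ => deriv H (z.1 + s * v.1)) (γ z.1 * v.1) 0 := by
    refine HasDerivAt.comp (0 : ℝ) (h₂ := deriv H) ?_ hx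
    simpa using hγ z.1
  have h4 := ((e1.add (e2.mul_const (v.1 + v.2))).add (e3.mul_const (v.1 - v.2))).sub
    ((e4.add e5).mul_const v.1)
  have h5 := h2.unique (h4.congr_of_eventuallyEq (Filter.Eventually.of_forall fun s => by
    simp [fderiv_waveExtension_apply c hf hG hH]))
  rw [h5]
  ring

end waveExtension

lemma norm_one_prod_le {σ : ℝ} (hσ : |σ| ≤ 1) : ‖((1 : ℝ), σ)‖ = 1 := by
  simpa [Prod.norm_def] using hσ

lemma norm_prod_one_le {σ : ℝ} (hσ : |σ| ≤ 1) : ‖(σ, (1 : ℝ))‖ = 1 := by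
  simpa [Prod.norm_def] using hσ

lemma exists_jet_extension {f : ℝ × ℝ → ℝ} (hf : ContDiff ℝ 2 f) {a b c k : ℝ} (hab : a < b)
    (hk : ∀ t ∈ Icc a b, ‖fderiv ℝ (fderiv ℝ f) (t, c)‖ ≤ k) :
    ∃ B : ℝ × ℝ → ℝ, ContDiff ℝ 2 B ∧
      (∀ t ∈ Ioo a b, secondJet f (t, c) = secondJet B (t, c)) ∧
      ∀ t ∈ Ioo a b, ∀ y,
        |fderiv ℝ B (t, y) (0, 1) - fderiv ℝ f (t, c) (0, 1)| ≤ 2 * k * |y - c| ∧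
        |fderiv ℝ B (t, y) (1, 0) - fderiv ℝ f (t, c) (1, 0)| ≤ 2 * k * |y - c| ∧
        ∀ σ, |fderiv ℝ (fderiv ℝ B) (t, y) (1, σ) (1, σ)| ≤ k * (4 + 2 * σ ^ 2) := by
  have hf1 : ContDiff ℝ 1 (fderiv ℝ f) := hf.fderiv_right (by norm_num)
  have hf2 : Continuous (fderiv ℝ (fderiv ℝ f)) := hf1.continuous_fderiv (by norm_num)
  have hq0 : Continuous fun u : ℝ =>
      fderiv ℝ (fderiv ℝ f) (max a (min b u), c) := hf2.comp (by fun_prop)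
  have hbound : ∀ u (v w : ℝ × ℝ), ‖v‖ = 1 → ‖w‖ = 1 →
      |fderiv ℝ (fderiv ℝ f) (max a (min b u), c) v w| ≤ k := by
    intro u v w hv hw
    have h := (fderiv ℝ (fderiv ℝ f) (max a (min b u), c)).le_opNorm₂ v w
    rw [hv, hw, mul_one, mul_one] at h
    exact h.trans (hk _ ⟨le_max_left _ _, max_le hab.le (min_le_left _ _)⟩)
  have hclamp : ∀ u ∈ Ioo a b, max a (min b u) = u := fun u hu => by
    rw [min_eq_right hu.2.le, max_eq_right hu.1.le]
  have e1 : ‖((1 : ℝ), (0 : ℝ))‖ = 1 := norm_one_prod_le (by simp)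
  have e2 : ‖((0 : ℝ), (1 : ℝ))‖ = 1 := norm_prod_one_le (by simp)
  set α : ℝ → ℝ := fun u => fderiv ℝ (fderiv ℝ f) (max a (min b u), c) (1, 0) (0, 1) with hα
  set q : ℝ → ℝ := fun u => fderiv ℝ (fderiv ℝ f) (max a (min b u), c) (0, 1) (0, 1) with hq
  have hαc : Continuous α := by fun_prop
  have hqc : Continuous q := by fun_prop
  have hαk : ∀ u, |α u| ≤ k := fun u => hbound u _ _ e1 e2
  have hqk : ∀ u, |q u| ≤ k := fun u => hbound u _ _ e2 e2
  obtain ⟨x₀, hx₀⟩ := exists_between hab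
  obtain ⟨G, hG, hG0, hG2⟩ := exists_deriv_hasDerivAt (β := fun u => (q u + α u) / 2)
    (by fun_prop) x₀ (fderiv ℝ f (x₀, c) (0, 1))
  obtain ⟨H, hH, hH0, hH2⟩ := exists_deriv_hasDerivAt (β := fun u => (q u - α u) / 2)
    (by fun_prop) x₀ 0
  have hGk : ∀ u, |(q u + α u) / 2| ≤ k := fun u => by
    have h1 := abs_le.1 (hαk u); have h2 := abs_le.1 (hqk u)
    rw [abs_le]; constructor <;> linarith
  have hHk : ∀ u, |(q u - α u) / 2| ≤ k := fun u => by
    have h1 := abs_le.1 (hαk u); have h2 := abs_le.1 (hqk u)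
    rw [abs_le]; constructor <;> linarith
  have hGL := abs_sub_le_of_hasDerivAt hG2 hGk
  have hHL := abs_sub_le_of_hasDerivAt hH2 hHk
  have hp : ∀ t ∈ Ioo a b, deriv G t - deriv H t = fderiv ℝ f (t, c) (0, 1) := by
    have hder : ∀ t ∈ Ioo a b, HasDerivAt
        (fun t => deriv G t - deriv H t - fderiv ℝ f (t, c) (0, 1)) 0 t := by
      intro t ht
      have h1 : HasDerivAt (fun t => fderiv ℝ f (t, c))
          (fderiv ℝ (fderiv ℝ f) (t, c) (1, 0)) t :=
        (hf1.differentiable (by norm_num) (t, c)).hasFDerivAt.comp_hasDerivAt t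
          ((hasDerivAt_id t).prodMk (hasDerivAt_const t c))
      have h2 := h1.clm_apply (hasDerivAt_const t ((0 : ℝ), (1 : ℝ)))
      refine (((hG2 t).sub (hH2 t)).sub h2).congr_deriv ?_
      simp only [hα, hclamp t ht, map_zero, add_zero]
      ring
    intro t ht
    have h := isOpen_Ioo.is_const_of_deriv_eq_zero isPreconnected_Ioo
      (fun t ht => (hder t ht).differentiableAt.differentiableWithinAt)
      (fun t ht => (hder t ht).deriv) ht hx₀
    simp only [hG0, hH0] at h
    linarith
  refine ⟨waveExtension f G H c, contDiff_waveExtension c hf hG hH, ?_, ?_⟩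
  · have hB := contDiff_waveExtension c hf hG hH
    have hB1 : Differentiable ℝ (fderiv ℝ (waveExtension f G H c)) :=
      (hB.fderiv_right (m := 1) (by norm_num)).differentiable (by norm_num)
    have hsub1 : fderiv ℝ (f - waveExtension f G H c) =
        fderiv ℝ f - fderiv ℝ (waveExtension f G H c) := funext fun z =>
      fderiv_sub (hf.differentiable (by norm_num) z) (hB.differentiable (by norm_num) z)
    have hsub2 : ∀ z, fderiv ℝ (fderiv ℝ (f - waveExtension f G H c)) z =
        fderiv ℝ (fderiv ℝ f) z - fderiv ℝ (fderiv ℝ (waveExtension f G H c)) z := fun z => by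
      rw [hsub1]
      exact fderiv_sub (hf1.differentiable (by norm_num) z) (hB1 z)
    intro t ht
    have hz := secondJet_eq_zero (a := a) (b := b) (c := c) (hf.sub hB) ?_ ?_ ?_ t ht
    · change secondJet (f - waveExtension f G H c) (t, c) = 0 at hz
      simp only [secondJet, hsub2, Prod.mk_eq_zero] at hz
      simp only [hsub1, Pi.sub_apply, sub_eq_zero] at hz
      have h2 : fderiv ℝ (fderiv ℝ f) (t, c) =
          fderiv ℝ (fderiv ℝ (waveExtension f G H c)) (t, c) := by
        refine ContinuousLinearMap.ext fun v => ?_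
        have h := congrArg (· v) hz.2.2
        simpa only [_root_.sub_apply, _root_.zero_apply, sub_eq_zero] using h
      simp only [secondJet, hz.1, hz.2.1, h2]
    · intro s hs
      simp [waveExtension]
    · intro s hs
      change fderiv ℝ (f - waveExtension f G H c) (s, c) (0, 1) = 0
      rw [hsub1, Pi.sub_apply, _root_.sub_apply,
        fderiv_waveExtension_apply c hf hG hH, ← hp s hs]
      simp [Prod.mk_zero_zero]
      ring
    · intro s hs
      change fderiv ℝ (fderiv ℝ (f - waveExtension f G H c)) (s, c) (0, 1) (0, 1) = 0
      rw [hsub2, _root_.sub_apply, _root_.sub_apply,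
        fderiv_fderiv_waveExtension_apply c hf hG hH hG2 hH2]
      simp only [hq, hα, hclamp s hs, Prod.mk_zero_zero, map_zero, sub_self, add_zero, sub_zero]
      ring
  · intro t ht y
    have hg := hGL t (t + (y - c))
    have hh := hHL t (t - (y - c))
    rw [show t + (y - c) - t = y - c by ring] at hg
    rw [show t - (y - c) - t = -(y - c) by ring, abs_neg] at hh
    rw [abs_le] at hg hh
    refine ⟨?_, ?_, fun σ => ?_⟩
    · rw [fderiv_waveExtension_apply c hf hG hH, ← hp t ht, abs_le]
      simp only [Prod.mk_zero_zero, map_zero]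
      constructor <;> linarith
    · rw [fderiv_waveExtension_apply c hf hG hH, abs_le]
      constructor <;> linarith
    · rw [fderiv_fderiv_waveExtension_apply c hf hG hH hG2 hH2]
      have h0 := abs_le.1 (hbound t _ _ e1 e1)
      rw [hclamp t ht] at h0
      have h1 := abs_le.1 (hGk (t + (y - c)))
      have h2 := abs_le.1 (hHk (t - (y - c)))
      have h3 := abs_le.1 (hqk t)
      rw [abs_le]
      constructor <;>
      nlinarith [mul_nonneg (sub_nonneg.2 h1.1) (sq_nonneg (1 + σ)),
        mul_nonneg (sub_nonneg.2 h1.2) (sq_nonneg (1 + σ)),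
        mul_nonneg (sub_nonneg.2 h2.1) (sq_nonneg (1 - σ)),
        mul_nonneg (sub_nonneg.2 h2.2) (sq_nonneg (1 - σ))]

lemma add_sub_le_of_hasDerivAt_of_le {u u' : ℝ → ℝ} {y₀ μ k R : ℝ} (hR : 0 ≤ R)
    (hu : ∀ y, HasDerivAt u (u' y) y) (h : ∀ y, μ - 2 * k * |y - y₀| ≤ u' y) :
    u y₀ + μ * R - k * R ^ 2 ≤ u (y₀ + R) ∧ u (y₀ - R) ≤ u y₀ - μ * R + k * R ^ 2 := by
  have hsq : ∀ y, HasDerivAt (fun y => (y - y₀) ^ 2) (2 * (y - y₀)) y := fun y => by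
    simpa using ((hasDerivAt_id y).sub_const y₀).fun_pow 2
  have hlin : ∀ y, HasDerivAt (fun y => μ * (y - y₀)) μ y := fun y => by
    simpa using ((hasDerivAt_id y).sub_const y₀).const_mul μ
  constructor
  · have hd : ∀ y, HasDerivAt (fun y => u y - μ * (y - y₀) + k * (y - y₀) ^ 2)
        (u' y - μ + k * (2 * (y - y₀))) y := fun y =>
      ((hu y).sub (hlin y)).add ((hsq y).const_mul k)
    have hm := monotoneOn_of_deriv_nonneg (convex_Icc y₀ (y₀ + R))
      (fun y _ => (hd y).continuousAt.continuousWithinAt)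
      (fun y _ => (hd y).differentiableAt.differentiableWithinAt) fun y hy => by
        rw [interior_Icc] at hy
        have := h y
        rw [abs_of_nonneg (by linarith [hy.1])] at this
        rw [(hd y).deriv]
        linarith
    have := hm (left_mem_Icc.2 (by linarith)) (right_mem_Icc.2 (by linarith)) (by linarith)
    simp only [sub_self, add_sub_cancel_left] at this
    linarith
  · have hd : ∀ y, HasDerivAt (fun y => u y - μ * (y - y₀) - k * (y - y₀) ^ 2)
        (u' y - μ - k * (2 * (y - y₀))) y := fun y =>
      ((hu y).sub (hlin y)).sub ((hsq y).const_mul k)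
    have hm := monotoneOn_of_deriv_nonneg (convex_Icc (y₀ - R) y₀)
      (fun y _ => (hd y).continuousAt.continuousWithinAt)
      (fun y _ => (hd y).differentiableAt.differentiableWithinAt) fun y hy => by
        rw [interior_Icc] at hy
        have := h y
        rw [abs_of_nonpos (by linarith [hy.2])] at this
        rw [(hd y).deriv]
        linarith
    have := hm (left_mem_Icc.2 (by linarith)) (right_mem_Icc.2 (by linarith)) (by linarith)
    simp only [sub_self, sub_sub_cancel_left] at this
    linarith

/-- A function with controlled derivatives on a box extends from the box to a `C²` function on
the vertical strip over it, with controlled derivatives. -/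
lemma exists_strip_extension {f : ℝ × ℝ → ℝ} (hf : ContDiff ℝ 2 f) {x : ℝ × ℝ} {ε k μ : ℝ}
    (hε : 0 < ε)
    (hb2 : ∀ t ∈ Icc (x.1 - ε) (x.1 + ε), ∀ y, |y - x.2| ≤ ε →
      ‖fderiv ℝ (fderiv ℝ f) (t, y)‖ ≤ k)
    (hμ : ∀ t ∈ Icc (x.1 - ε) (x.1 + ε), ∀ y, |y - x.2| ≤ ε →
      μ ≤ fderiv ℝ f (t, y) (0, 1) ∧ |fderiv ℝ f (t, y) (1, 0)| ≤ k - μ) :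
    ∃ F : ℝ × ℝ → ℝ, ContDiffOn ℝ 2 F (Ioo (x.1 - ε) (x.1 + ε) ×ˢ univ) ∧
      ∀ t ∈ Ioo (x.1 - ε) (x.1 + ε), ∀ y, (|y - x.2| ≤ ε → F (t, y) = f (t, y)) ∧
        μ - 2 * k * |y - x.2| ≤ fderiv ℝ F (t, y) (0, 1) ∧
        |fderiv ℝ F (t, y) (1, 0)| ≤ k - μ + 2 * k * |y - x.2| ∧
        ∀ σ, |fderiv ℝ (fderiv ℝ F) (t, y) (1, σ) (1, σ)| ≤ k * (4 + 2 * σ ^ 2) := by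
  have hk : 0 ≤ k := by
    have h := hb2 x.1 ⟨by linarith, by linarith⟩ x.2 (by rw [sub_self, abs_zero]; exact hε.le)
    exact (norm_nonneg (fderiv ℝ (fderiv ℝ f) (x.1, x.2))).trans h
  have hab : x.1 - ε < x.1 + ε := by linarith
  have hbot : |x.2 - ε - x.2| ≤ ε := by simp [abs_of_pos hε]
  have htop : |x.2 + ε - x.2| ≤ ε := by simp [abs_of_pos hε]
  obtain ⟨B₁, hB₁, hJ₁, hB₁b⟩ := exists_jet_extension hf hab fun t ht => hb2 t ht _ hbot
  obtain ⟨B₂, hB₂, hJ₂, hB₂b⟩ := exists_jet_extension hf hab fun t ht => hb2 t ht _ htop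
  have hS : IsOpen (Ioo (x.1 - ε) (x.1 + ε) ×ˢ (univ : Set ℝ)) := isOpen_Ioo.prod isOpen_univ
  obtain ⟨hF₁, hF₁J⟩ := contDiffOn_ite_snd_le (c := x.2 + ε) hS hf.contDiffOn hB₂.contDiffOn
    (by rintro ⟨t, y⟩ hz rfl; exact hJ₂ t hz.1)
  set F₁ : ℝ × ℝ → ℝ := fun w => if w.2 ≤ x.2 + ε then f w else B₂ w
  obtain ⟨hF, hFJ⟩ := contDiffOn_ite_snd_le (c := x.2 - ε) hS hB₁.contDiffOn hF₁
    (by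
      rintro ⟨t, y⟩ hz rfl
      rw [hF₁J _ hz, if_pos (by simp only; linarith)]
      exact (hJ₁ t hz.1).symm)
  set F : ℝ × ℝ → ℝ := fun w => if w.2 ≤ x.2 - ε then B₁ w else F₁ w
  refine ⟨F, hF, fun t ht y => ?_⟩
  have hFty := hFJ (t, y) ⟨ht, mem_univ _⟩
  have hF₁ty := hF₁J (t, y) ⟨ht, mem_univ _⟩
  have ht' := Ioo_subset_Icc_self ht
  simp only at hFty hF₁ty
  have hin : |y - x.2| ≤ ε → secondJet F (t, y) = secondJet f (t, y) := by
    intro hy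
    rw [abs_le] at hy
    rw [hFty]
    split_ifs with h
    · obtain rfl : y = x.2 - ε := by linarith
      exact (hJ₁ t ht).symm
    · rw [hF₁ty, if_pos (by linarith)]
  refine ⟨fun hy => congrArg Prod.fst (hin hy), ?_⟩
  rcases le_or_gt |y - x.2| ε with hy | hy
  · have hJ := hin hy
    simp only [secondJet, Prod.mk.injEq] at hJ
    rw [hJ.2.1, hJ.2.2]
    have h1 := hμ t ht' y hy
    have h2 : 0 ≤ 2 * k * |y - x.2| := by positivity
    refine ⟨by linarith, by linarith, fun σ => ?_⟩
    have h3 := (fderiv ℝ (fderiv ℝ f) (t, y)).le_opNorm₂ (1, σ) (1, σ)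
    have h4 : ‖((1 : ℝ), σ)‖ * ‖((1 : ℝ), σ)‖ ≤ 1 + σ ^ 2 := by
      rw [Prod.norm_def]
      rcases max_choice ‖(1 : ℝ)‖ ‖σ‖ with h | h <;> simp only [h]
      · simp; positivity
      · rw [Real.norm_eq_abs, abs_mul_abs_self]; nlinarith
    rw [mul_assoc] at h3
    refine (h3.trans (mul_le_mul (hb2 t ht' y hy) h4 (by positivity) hk)).trans ?_
    exact mul_le_mul_of_nonneg_left (by nlinarith [sq_nonneg σ]) hk
  · rcases lt_abs.1 hy with h | h
    · have hJ : secondJet F (t, y) = secondJet B₂ (t, y) := by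
        rw [hFty, if_neg (by linarith), hF₁ty, if_neg (by linarith)]
      simp only [secondJet, Prod.mk.injEq] at hJ
      rw [hJ.2.1, hJ.2.2]
      obtain ⟨h1, h2, h3⟩ := hB₂b t ht y
      obtain ⟨h4, h5⟩ := hμ t ht' _ htop
      have h6 : 2 * k * |y - (x.2 + ε)| ≤ 2 * k * |y - x.2| := by
        rw [abs_of_pos (by linarith), abs_of_pos (by linarith)]; nlinarith
      rw [abs_le] at h1 h2 h5
      exact ⟨by linarith, abs_le.2 ⟨by linarith, by linarith⟩, h3⟩
    · have hJ : secondJet F (t, y) = secondJet B₁ (t, y) := by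
        rw [hFty, if_pos (by linarith)]
      simp only [secondJet, Prod.mk.injEq] at hJ
      rw [hJ.2.1, hJ.2.2]
      obtain ⟨h1, h2, h3⟩ := hB₁b t ht y
      obtain ⟨h4, h5⟩ := hμ t ht' _ hbot
      have h6 : 2 * k * |y - (x.2 - ε)| ≤ 2 * k * |y - x.2| := by
        rw [abs_of_neg (by linarith), abs_of_neg (by linarith)]; nlinarith
      rw [abs_le] at h1 h2 h5
      exact ⟨by linarith, abs_le.2 ⟨by linarith, by linarith⟩, h3⟩

lemma exists_nodal_graph_of_deriv_pos {k lam : ℝ} (hlam : 0 < lam) (hk : lam ≤ k)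
    {f : ℝ × ℝ → ℝ} (hf : ContDiff ℝ 2 f) {x : ℝ × ℝ} (hx0 : f x = 0)
    (hx2 : lam / Real.sqrt 2 ≤ fderiv ℝ f x (0, 1))
    {ε : ℝ} (hε : ε = (lam / (4 * k)) ^ 2)
    (hdf : ∀ y : ℝ × ℝ, |y.1 - x.1| ≤ ε → |y.2 - x.2| ≤ ε →
      ‖fderiv ℝ f y‖ ≤ k ∧ ‖fderiv ℝ (fderiv ℝ f) y‖ ≤ k) :
    ∃ φ : ℝ → ℝ, ContDiffOn ℝ 2 φ (Ioo (x.1 - ε) (x.1 + ε)) ∧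
      (∀ y : ℝ × ℝ, |y.1 - x.1| < ε → |y.2 - x.2| ≤ ε → (f y = 0 ↔ y.2 = φ y.1)) ∧
      ∀ t ∈ Ioo (x.1 - ε) (x.1 + ε), |deriv (deriv φ) t| ≤ 100 * (k / lam) ^ 3 := by
  have hk0 : 0 < k := hlam.trans_le hk
  have hε0 : 0 < ε := by rw [hε]; positivity
  set R : ℝ := lam / (8 * k) with hR
  have hR0 : 0 < R := by positivity
  have hkR : k * R = lam / 8 := by rw [hR]; field_simp
  have hεR : ε = 4 * R * R := by rw [hε, hR]; field_simp; norm_num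
  have hR8 : R ≤ 1 / 8 := by
    rw [hR, div_le_div_iff₀ (by positivity) (by norm_num)]; linarith
  have hkε : k * ε = lam / 2 * R := by rw [hεR]; linear_combination 4 * R * hkR
  have hkε' : k * ε ≤ lam / 16 := by rw [hkε]; nlinarith
  have hεR' : ε ≤ R := by rw [hεR]; nlinarith
  have hball : ∀ z ∈ Metric.closedBall x ε, |z.1 - x.1| ≤ ε ∧ |z.2 - x.2| ≤ ε := by
    intro z hz
    rw [mem_closedBall_iff_norm, Prod.norm_def, max_le_iff] at hz
    exact hz
  have hball' : ∀ t ∈ Icc (x.1 - ε) (x.1 + ε), ∀ y, |y - x.2| ≤ ε →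
      (t, y) ∈ Metric.closedBall x ε := by
    intro t ht y hy
    rw [mem_closedBall_iff_norm, Prod.norm_def, max_le_iff]
    have h : |t - x.1| ≤ ε := abs_le.2 ⟨by linarith [ht.1], by linarith [ht.2]⟩
    exact ⟨h, hy⟩
  have hxb : x ∈ Metric.closedBall x ε := Metric.mem_closedBall_self hε0.le
  have hf1 : ContDiff ℝ 1 (fderiv ℝ f) := hf.fderiv_right (by norm_num)
  have hfb : ∀ z ∈ Metric.closedBall x ε, |f z| ≤ k * ε := by
    intro z hz
    have h := (convex_closedBall x ε).norm_image_sub_le_of_norm_fderiv_le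
      (fun w _ => hf.differentiable (by norm_num) w)
      (fun w hw => (hdf w (hball w hw).1 (hball w hw).2).1) hxb hz
    rw [hx0, sub_zero] at h
    exact h.trans (mul_le_mul_of_nonneg_left (mem_closedBall_iff_norm.1 hz) hk0.le)
  have hf2b : ∀ z ∈ Metric.closedBall x ε, 16 / 25 * lam ≤ fderiv ℝ f z (0, 1) := by
    intro z hz
    have h := (convex_closedBall x ε).norm_image_sub_le_of_norm_fderiv_le
      (fun w _ => hf1.differentiable (by norm_num) w)
      (fun w hw => (hdf w (hball w hw).1 (hball w hw).2).2) hxb hz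
    have h1 := ((fderiv ℝ f z - fderiv ℝ f x).le_opNorm (0, 1)).trans
      (mul_le_mul_of_nonneg_right
        (h.trans (mul_le_mul_of_nonneg_left (mem_closedBall_iff_norm.1 hz) hk0.le))
        (norm_nonneg _))
    rw [norm_prod_one_le (by simp), mul_one, Real.norm_eq_abs, _root_.sub_apply, abs_le] at h1
    have hs : Real.sqrt 2 ≤ 1.42 := Real.sqrt_le_iff.2 ⟨by norm_num, by norm_num⟩
    have h2 : 0.703 * lam ≤ lam / Real.sqrt 2 := by
      rw [le_div_iff₀ (by positivity)]
      nlinarith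
    linarith [h1.1]
  have hf1b : ∀ z ∈ Metric.closedBall x ε,
      |fderiv ℝ f z (1, 0)| ≤ k - 16 / 25 * lam := by
    intro z hz
    have h0 := (hdf z (hball z hz).1 (hball z hz).2).1
    have hσ : ∀ σ : ℝ, |σ| ≤ 1 → σ * fderiv ℝ f z (1, 0) + fderiv ℝ f z (0, 1) ≤ k := by
      intro σ hσ
      have h1 := (fderiv ℝ f z).le_opNorm (σ, 1)
      rw [norm_prod_one_le hσ, mul_one] at h1
      have h2 : (σ, (1 : ℝ)) = σ • ((1 : ℝ), (0 : ℝ)) + ((0 : ℝ), (1 : ℝ)) := by simp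
      rw [h2, map_add, map_smul, smul_eq_mul] at h1
      exact (le_abs_self _).trans (h1.trans h0)
    have h1 := hσ 1 (by simp)
    have h2 := hσ (-1) (by simp)
    have h3 := hf2b z hz
    rw [abs_le]
    constructor <;> linarith
  obtain ⟨F, hF, hFb⟩ := exists_strip_extension (x := x) (k := k) (μ := 16 / 25 * lam) hf hε0
    (fun t ht y hy => (hdf _ (hball _ (hball' t ht y hy)).1 (hball _ (hball' t ht y hy)).2).2)
    (fun t ht y hy => ⟨hf2b _ (hball' t ht y hy), hf1b _ (hball' t ht y hy)⟩)
  have hS : IsOpen (Ioo (x.1 - ε) (x.1 + ε) ×ˢ (univ : Set ℝ)) := isOpen_Ioo.prod isOpen_univ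
  have hslope : ∀ t ∈ Ioo (x.1 - ε) (x.1 + ε), ∀ y, |y - x.2| ≤ R →
      39 / 100 * lam ≤ fderiv ℝ F (t, y) (0, 1) ∧ |fderiv ℝ F (t, y) (1, 0)| ≤ k := by
    intro t ht y hy
    obtain ⟨-, h1, h2, -⟩ := hFb t ht y
    have : k * |y - x.2| ≤ lam / 8 := by
      rw [← hkR]; exact mul_le_mul_of_nonneg_left hy hk0.le
    constructor <;> linarith
  have hends : ∀ t ∈ Ioo (x.1 - ε) (x.1 + ε), F (t, x.2 - R) < 0 ∧ 0 < F (t, x.2 + R) := by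
    intro t ht
    have hd : ∀ y, HasDerivAt (fun y => F (t, y)) (fderiv ℝ F (t, y) (0, 1)) y := fun y =>
      ((hF.contDiffAt (hS.mem_nhds ⟨ht, mem_univ y⟩)).differentiableAt
        (by norm_num)).hasFDerivAt.comp_hasDerivAt y
          ((hasDerivAt_const y t).prodMk (hasDerivAt_id y))
    have h := add_sub_le_of_hasDerivAt_of_le (y₀ := x.2) hR0.le hd fun y => (hFb t ht y).2.1
    have hxx : |x.2 - x.2| ≤ ε := by simpa using hε0.le
    have h0 := hfb _ (hball' t (Ioo_subset_Icc_self ht) x.2 hxx)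
    rw [← (hFb t ht x.2).1 hxx, hkε, abs_le] at h0
    have hkR2 : k * R ^ 2 = lam / 8 * R := by rw [sq, ← mul_assoc, hkR]
    have hlR : 0 < lam * R := mul_pos hlam hR0
    rw [hkR2] at h
    constructor <;> linarith [h.1, h.2, h0.1, h0.2]
  obtain ⟨φ, hφ, hφr⟩ := exists_contDiffOn_root hR0.le hF
    (fun t ht y hy => (by positivity : (0 : ℝ) < 39 / 100 * lam).trans_le (hslope t ht y hy).1)
    (fun t ht => (hends t ht).1) (fun t ht => (hends t ht).2)
  refine ⟨φ, hφ, ?_, ?_⟩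
  · rintro ⟨t, y⟩ ht hy
    rw [abs_lt] at ht
    have ht' : t ∈ Ioo (x.1 - ε) (x.1 + ε) := ⟨by linarith [ht.1], by linarith [ht.2]⟩
    rw [← (hFb t ht' y).1 hy]
    exact (hφr t ht').2 y (hy.trans hεR')
  · intro t ht
    obtain ⟨h1, h2⟩ := deriv_implicit_eq hF hφ
      (fun s hs => ((hφr s hs).2 _ (hφr s hs).1).2 rfl) ht
    obtain ⟨h3, h4⟩ := hslope t ht _ (hφr t ht).1
    have h5 := (hFb t ht (φ t)).2.2.2 (deriv φ t)
    set σ := deriv φ t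
    set p := fderiv ℝ F (t, φ t) (0, 1)
    rw [show ((1 : ℝ), σ) = ((1 : ℝ), (0 : ℝ)) + σ • ((0 : ℝ), (1 : ℝ)) by simp, map_add,
      map_smul, smul_eq_mul] at h1
    have hp : 0 < p := (by positivity : (0 : ℝ) < 39 / 100 * lam).trans_le h3
    have hσ : |σ| * p ≤ k := by
      rw [← abs_of_pos hp, ← abs_mul, show σ * p = -fderiv ℝ F (t, φ t) (1, 0) by linarith,
        abs_neg]
      exact h4
    have hdd : |deriv (deriv φ) t| * p ≤ k * (4 + 2 * σ ^ 2) := by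
      rw [← abs_of_pos hp, ← abs_mul, eq_neg_of_add_eq_zero_right h2, abs_neg]
      exact h5
    set K := k / lam with hK
    have hkK : k = K * lam := by rw [hK]; field_simp
    have hK1 : 1 ≤ K := by rw [hK, le_div_iff₀ hlam]; linarith
    have hσK : |σ| ≤ 3 * K := by
      have : |σ| * (39 / 100 * lam) ≤ K * lam :=
        (mul_le_mul_of_nonneg_left h3 (abs_nonneg _)).trans (hkK ▸ hσ)
      nlinarith [abs_nonneg σ]
    have hσ2 : σ ^ 2 ≤ 9 * K ^ 2 := by
      rw [← sq_abs]; nlinarith [abs_nonneg σ]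
    have hfin : |deriv (deriv φ) t| * (39 / 100) ≤ K * (4 + 2 * σ ^ 2) := by
      have : |deriv (deriv φ) t| * (39 / 100 * lam) ≤ K * lam * (4 + 2 * σ ^ 2) :=
        (mul_le_mul_of_nonneg_left h3 (abs_nonneg _)).trans (hkK ▸ hdd)
      refine le_of_mul_le_mul_right ?_ hlam
      linarith
    have hK3 : K ≤ K ^ 3 := le_self_pow₀ hK1 (by norm_num)
    have hKσ : K * (4 + 2 * σ ^ 2) ≤ 4 * K + 18 * K ^ 3 := by nlinarith
    linarith

/-- Let `k ≥ λ > 0`, `U ⊆ ℝ²` open, `f : ℝ² → ℝ` be `C²` with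
`‖df‖_{C¹(U)} ≤ k`. If `f x = 0`, `|∂₂ f(x)| ≥ λ/√2` and `ε = (λ/(4k))²` (with
`b[x,ε] ⊆ U`), then on the box `b[x,ε]` the zero set of `f` is the graph of a `C²` function
`φ` on `I_ε = {t : |t - x₁| < ε}` and `‖φ''‖_{L^∞(I_ε)} ≤ 100 (k/λ)³`. -/
theorem nodal_graph_box (k lam : ℝ) (hlam : 0 < lam) (hk : lam ≤ k)
    (U : Set (ℝ × ℝ)) (hU : IsOpen U)
    (f : ℝ × ℝ → ℝ) (hf : ContDiff ℝ 2 f)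
    (hdf : ∀ y ∈ U, ‖fderiv ℝ f y‖ ≤ k ∧ ‖fderiv ℝ (fderiv ℝ f) y‖ ≤ k)
    (x : ℝ × ℝ) (hx0 : f x = 0)
    (hx2 : lam / Real.sqrt 2 ≤ |fderiv ℝ f x (0, 1)|)
    (ε : ℝ) (hε : ε = (lam / (4 * k)) ^ 2)
    (hbox : {y : ℝ × ℝ | |y.1 - x.1| ≤ ε ∧ |y.2 - x.2| ≤ ε} ⊆ U) :
    ∃ φ : ℝ → ℝ, ContDiffOn ℝ 2 φ (Ioo (x.1 - ε) (x.1 + ε)) ∧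
      (∀ y : ℝ × ℝ, |y.1 - x.1| < ε → |y.2 - x.2| ≤ ε → (f y = 0 ↔ y.2 = φ y.1)) ∧
      ∀ t ∈ Ioo (x.1 - ε) (x.1 + ε), |deriv (deriv φ) t| ≤ 100 * (k / lam) ^ 3 := by
  have hbox' : ∀ y : ℝ × ℝ, |y.1 - x.1| ≤ ε → |y.2 - x.2| ≤ ε →
      ‖fderiv ℝ f y‖ ≤ k ∧ ‖fderiv ℝ (fderiv ℝ f) y‖ ≤ k := fun y h1 h2 => hdf y (hbox ⟨h1, h2⟩)
  rcases le_abs.1 hx2 with h | h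
  · exact exists_nodal_graph_of_deriv_pos hlam hk hf hx0 h hε hbox'
  · have hneg : fderiv ℝ (-f) = -fderiv ℝ f := funext fun y => fderiv_neg
    have hneg2 : ∀ y, fderiv ℝ (fderiv ℝ (-f)) y = -fderiv ℝ (fderiv ℝ f) y := fun y => by
      rw [hneg]; exact fderiv_neg
    have := exists_nodal_graph_of_deriv_pos (f := -f) hlam hk hf.neg (x := x) (by simp [hx0])
      (by rw [hneg]; exact h) hε fun y h1 h2 => by
        rw [hneg2, hneg, Pi.neg_apply, norm_neg]
        exact ⟨(hbox' y h1 h2).1, (norm_neg (fderiv ℝ (fderiv ℝ f) y)).trans_le (hbox' y h1 h2).2⟩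
    simpa only [Pi.neg_apply, neg_eq_zero] using this
end
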